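/- arXiv:2211.12411 — 9 statements merged into one kernel-verified Lean document; each statement's English description precedes it below -/
import Mathlib

section
/- Let p, q be coprime positive integers with p ≠ q. Suppose the two reversibility identities (p/q)·x^{1−q/p}·F₂(y^{p/q}, x^{q/p}) = −F₁(x,y) and (q/p)·y^{1−p/q}·F₁(y^{p/q}, x^{q/p}) = −F₂(x,y) hold for all real x > 0, y > 0. Then this holds if and only if: a_{jk} = 0 unless (j,k) = (q·u, p·v) for some u, v ∈ ℕ; b_{kj} = 0 unless (k,j) = (q·v, p·u) for some u, v ∈ ℕ; and b_{q v, p u} = (q/p)·a_{q u, p v} for all u, v ∈ ℕ with u + v ≥ 1. -/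
/-- The real monomials `x ^ α * y ^ β`, written in logarithmic coordinates, as characters. -/
noncomputable def expChar (e : ℝ × ℝ) : Multiplicative (ℝ × ℝ) →* ℝ where
  toFun z := Real.exp (e.1 * z.toAdd.1 + e.2 * z.toAdd.2)
  map_one' := by simp
  map_mul' z w := by
    rw [← Real.exp_add]
    congr 1
    simp only [toAdd_mul, Prod.fst_add, Prod.snd_add]
    ring

theorem expChar_injective : Function.Injective expChar := by
  intro e f h
  have h₁ := DFunLike.congr_fun h (Multiplicative.ofAdd ((1 : ℝ), (0 : ℝ)))
  have h₂ := DFunLike.congr_fun h (Multiplicative.ofAdd ((0 : ℝ), (1 : ℝ)))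
  simp only [expChar, MonoidHom.coe_mk, OneHom.coe_mk, toAdd_ofAdd, Real.exp_eq_exp] at h₁ h₂
  ext <;> linarith

/-- Distinct real monomials are linearly independent on the open positive quadrant. -/
theorem finsupp_eq_of_sum_rpow_eq {c d : ℝ × ℝ →₀ ℝ}
    (h : ∀ x y : ℝ, 0 < x → 0 < y →
      (c.sum fun e r => r * (x ^ e.1 * y ^ e.2)) = d.sum fun e r => r * (x ^ e.1 * y ^ e.2)) :
    c = d := by
  have hli : LinearIndependent ℝ fun e : ℝ × ℝ => (expChar e : Multiplicative (ℝ × ℝ) → ℝ) :=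
    (linearIndependent_monoidHom (Multiplicative (ℝ × ℝ)) ℝ).comp _ expChar_injective
  apply hli
  funext z
  have hz := h (Real.exp z.toAdd.1) (Real.exp z.toAdd.2) (Real.exp_pos _) (Real.exp_pos _)
  simp only [← Real.exp_mul, ← Real.exp_add] at hz
  simpa [Finsupp.linearCombination_apply, Finsupp.sum, Finset.sum_apply, expChar, mul_comm]
    using hz

theorem finsum_eq_finsum_comp_of_support_subset_range {α β M : Type*} [AddCommMonoid M]
    {e : β → α} (he : Function.Injective e) {f : α → M}
    (hf : Function.support f ⊆ Set.range e) : ∑ᶠ i, f i = ∑ᶠ j, f (e j) := by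
  rw [← finsum_mem_range he, ← finsum_mem_univ,
    ← finsum_mem_inter_support f Set.univ, ← finsum_mem_inter_support f (Set.range e),
    Set.univ_inter, Set.inter_eq_right.mpr hf]

theorem finsum_mul_eq_finsupp_sum {α : Type*} {a : α → ℝ} (ha : (Function.support a).Finite)
    (g : α → ℝ) : ∑ᶠ i, a i * g i = (Finsupp.ofSupportFinite a ha).sum fun i r => r * g i := by
  refine finsum_eq_sum_of_support_subset _ fun i hi => ?_
  have : a i ≠ 0 := left_ne_zero_of_mul hi
  simpa [Finsupp.ofSupportFinite] using this

/-- The solutions in natural numbers of the resonance relation `p (m - 1) = q (n - 1)`. -/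
theorem Nat.Coprime.exists_eq_mul_add_one {p q m n : ℕ} (hp : 0 < p) (hq : 0 < q)
    (hpq : Nat.Coprime p q) (hne : p ≠ q) (h : p * m + q = q * n + p) :
    ∃ u, m = q * u + 1 ∧ n = p * u + 1 := by
  obtain _ | m := m
  · obtain _ | n := n
    · simp at h; omega
    · exfalso; nlinarith [Nat.zero_le (q * n)]
  obtain _ | n := n
  · exfalso; nlinarith [Nat.zero_le (p * m)]
  have h' : p * m = q * n := by nlinarith
  obtain ⟨u, rfl⟩ : q ∣ m := hpq.symm.dvd_of_dvd_mul_left ⟨n, h'⟩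
  refine ⟨u, rfl, ?_⟩
  have : n = p * u := Nat.eq_of_mul_eq_mul_left hq (by rw [← h']; ring)
  rw [this]

theorem Nat.Coprime.exists_eq_mul {p q k l : ℕ} (hq : 0 < q)
    (hpq : Nat.Coprime p q) (h : p * k = q * l) : ∃ v, k = q * v ∧ l = p * v := by
  obtain ⟨v, rfl⟩ : q ∣ k := hpq.symm.dvd_of_dvd_mul_left ⟨l, h⟩
  exact ⟨v, rfl, Nat.eq_of_mul_eq_mul_left hq (by rw [← h]; ring)⟩

/-- The effect of the change of variables `(x, y) ↦ (y ^ (p/q), x ^ (q/p))`, with its weight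
`x ^ (1 - q/p)`, on a monomial. -/
theorem rpow_mul_monomial_comp {x y r s : ℝ} (hx : 0 < x) (hy : 0 < y) (k m : ℕ) :
    x ^ (1 - r) * ((y ^ s) ^ k * (x ^ r) ^ m) = x ^ (1 + r * (m - 1)) * y ^ (s * k) := by
  rw [← Real.rpow_natCast (y ^ s), ← Real.rpow_natCast (x ^ r), ← Real.rpow_mul hy.le,
    ← Real.rpow_mul hx.le, mul_left_comm, ← Real.rpow_add hx, mul_comm]
  ring_nf

/-- The exponent of the image of the monomial with exponent `(k, m)` under the involution. -/
noncomputable def involutionExponent (p q : ℕ) (e : ℕ × ℕ) : ℝ × ℝ :=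
  (1 + (q : ℝ) / p * (e.2 - 1), (p : ℝ) / q * e.1)

theorem involutionExponent_injective {p q : ℕ} (hp : 0 < p) (hq : 0 < q) :
    Function.Injective (involutionExponent p q) := by
  rintro ⟨k, m⟩ ⟨k', m'⟩ h
  have hp' : (p : ℝ) ≠ 0 := by positivity
  have hq' : (q : ℝ) ≠ 0 := by positivity
  simpa [involutionExponent, hp', hq', and_comm] using h

theorem involutionExponent_eq_iff {p q : ℕ} (hp : 0 < p) (hq : 0 < q)
    (hpq : Nat.Coprime p q) (hne : p ≠ q) (k m m' k' : ℕ) :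
    involutionExponent p q (k, m) = ((m' : ℝ), (k' : ℝ)) ↔
      ∃ u v, k = q * v ∧ m = p * u + 1 ∧ m' = q * u + 1 ∧ k' = p * v := by
  have hp' : (p : ℝ) ≠ 0 := by positivity
  have hq' : (q : ℝ) ≠ 0 := by positivity
  constructor
  · intro h
    simp only [involutionExponent, Prod.mk.injEq] at h
    obtain ⟨h₁, h₂⟩ := h
    field_simp at h₁ h₂
    obtain ⟨u, hm', hm⟩ := hpq.exists_eq_mul_add_one (m := m') (n := m) hp hq hne (by
      have : (p : ℝ) * m' + q = q * m + p := by linarith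
      exact_mod_cast this)
    obtain ⟨v, hk, hk'⟩ := hpq.exists_eq_mul (k := k) (l := k') hq (by
      have : (p : ℝ) * k = q * k' := by linarith
      exact_mod_cast this)
    exact ⟨u, v, hk, hm, hm', hk'⟩
  · rintro ⟨u, v, rfl, rfl, rfl, rfl⟩
    simp only [involutionExponent, Prod.mk.injEq]
    push_cast
    constructor
    · field_simp
      ring
    · field_simp

theorem mul_rpow_mul_finsum {x y r s w : ℝ} (hx : 0 < x) (hy : 0 < y)
    (b : ℕ × ℕ → ℝ) :
    w * x ^ (1 - r) * ∑ᶠ e : ℕ × ℕ, b e * (y ^ s) ^ e.1 * (x ^ r) ^ e.2 =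
      ∑ᶠ e : ℕ × ℕ, w * b e * (x ^ (1 + r * (e.2 - 1)) * y ^ (s * e.1)) := by
  rw [mul_finsum]
  refine finsum_congr fun e => ?_
  rw [← rpow_mul_monomial_comp hx hy]
  ring

theorem mapDomain_eq_of_reversible {p q : ℕ} {a b : ℕ × ℕ → ℝ}
    (ha : (Function.support a).Finite)
    (hb : (Function.support fun e => (p : ℝ) / q * b e).Finite)
    (h : ∀ x y : ℝ, 0 < x → 0 < y →
      ∑ᶠ e : ℕ × ℕ, (p : ℝ) / q * b e *
        (x ^ (1 + (q : ℝ) / p * (e.2 - 1)) * y ^ ((p : ℝ) / q * e.1)) =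
      ∑ᶠ e : ℕ × ℕ, a e * x ^ e.1 * y ^ e.2) :
    (Finsupp.ofSupportFinite _ hb).mapDomain (involutionExponent p q) =
      (Finsupp.ofSupportFinite a ha).mapDomain (Prod.map (↑) (↑)) := by
  refine finsupp_eq_of_sum_rpow_eq fun x y hx hy => ?_
  rw [Finsupp.sum_mapDomain_index (by simp) (by intros; ring),
    Finsupp.sum_mapDomain_index (by simp) (by intros; ring)]
  have := h x y hx hy
  simp only [mul_assoc (a _)] at this
  rw [finsum_mul_eq_finsupp_sum hb, finsum_mul_eq_finsupp_sum ha] at this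
  simpa [involutionExponent] using this

theorem coefficients_of_reversible {p q : ℕ} (hp : 0 < p) (hq : 0 < q)
    (hpq : Nat.Coprime p q) (hne : p ≠ q) {a b : ℕ × ℕ → ℝ}
    (ha : (Function.support a).Finite) (hb : (Function.support b).Finite)
    (h : ∀ x y : ℝ, 0 < x → 0 < y →
      ∑ᶠ e : ℕ × ℕ, (p : ℝ) / q * b e *
        (x ^ (1 + (q : ℝ) / p * (e.2 - 1)) * y ^ ((p : ℝ) / q * e.1)) =
      ∑ᶠ e : ℕ × ℕ, a e * x ^ e.1 * y ^ e.2) :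
    (∀ m k : ℕ, a (m, k) ≠ 0 → ∃ u v : ℕ, m = q * u + 1 ∧ k = p * v) ∧
    (∀ k m : ℕ, b (k, m) ≠ 0 → ∃ u v : ℕ, k = q * v ∧ m = p * u + 1) ∧
    (∀ u v : ℕ, b (q * v, p * u + 1) = ((q : ℝ) / p) * a (q * u + 1, p * v)) := by
  have hp' : (p : ℝ) ≠ 0 := by positivity
  have hq' : (q : ℝ) ≠ 0 := by positivity
  have hb' : (Function.support fun e => (p : ℝ) / q * b e).Finite :=
    hb.subset fun e he => right_ne_zero_of_mul he
  have key := mapDomain_eq_of_reversible ha hb' h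
  have hφ := involutionExponent_injective hp hq
  have hψ : Function.Injective (Prod.map (↑) (↑) : ℕ × ℕ → ℝ × ℝ) :=
    Nat.cast_injective.prodMap Nat.cast_injective
  have hA (e : ℕ × ℕ) : (Finsupp.ofSupportFinite a ha).mapDomain
      (Prod.map (↑) (↑) : ℕ × ℕ → ℝ × ℝ) (Prod.map (↑) (↑) e) = a e :=
    Finsupp.mapDomain_apply hψ _ e
  have hB (e : ℕ × ℕ) : (Finsupp.ofSupportFinite _ hb').mapDomain
      (involutionExponent p q) (involutionExponent p q e) = (p : ℝ) / q * b e :=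
    Finsupp.mapDomain_apply hφ _ e
  refine ⟨fun m k hmk => ?_, fun k m hkm => ?_, fun u v => ?_⟩
  · by_cases hr : Prod.map (↑) (↑) (m, k) ∈ Set.range (involutionExponent p q)
    · obtain ⟨⟨k', m'⟩, he⟩ := hr
      obtain ⟨u, v, -, -, hm, hk⟩ := (involutionExponent_eq_iff hp hq hpq hne _ _ _ _).mp he
      exact ⟨u, v, hm, hk⟩
    · rw [← hA, ← key, Finsupp.mapDomain_of_notMem_range _ _ hr] at hmk
      exact absurd rfl hmk
  · have hkm' : (p : ℝ) / q * b (k, m) ≠ 0 := by positivity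
    by_cases hr : involutionExponent p q (k, m) ∈
        Set.range (Prod.map (↑) (↑) : ℕ × ℕ → ℝ × ℝ)
    · obtain ⟨⟨m', k'⟩, he⟩ := hr
      obtain ⟨u, v, hk, hm, -, -⟩ :=
        (involutionExponent_eq_iff hp hq hpq hne _ _ _ _).mp he.symm
      exact ⟨u, v, hk, hm⟩
    · rw [← hB, key, Finsupp.mapDomain_of_notMem_range _ _ hr] at hkm'
      exact absurd rfl hkm'
  · have he : involutionExponent p q (q * v, p * u + 1) =
        Prod.map (↑) (↑) (q * u + 1, p * v) :=
      (involutionExponent_eq_iff hp hq hpq hne _ _ _ _).mpr ⟨u, v, rfl, rfl, rfl, rfl⟩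
    have h₁ := hB (q * v, p * u + 1)
    rw [key, he, hA] at h₁
    rw [h₁]
    field_simp

theorem rpow_one_add_div_mul {p q : ℕ} (hp : 0 < p) (x : ℝ) (u : ℕ) :
    x ^ (1 + (q : ℝ) / p * (((p * u + 1 : ℕ) : ℝ) - 1)) = x ^ (q * u + 1) := by
  have hp' : (p : ℝ) ≠ 0 := by positivity
  rw [← Real.rpow_natCast]
  congr 1
  push_cast
  field_simp
  ring

theorem rpow_div_mul_natCast {p q : ℕ} (hq : 0 < q) (y : ℝ) (v : ℕ) :
    y ^ ((p : ℝ) / q * ((q * v : ℕ) : ℝ)) = y ^ (p * v) := by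
  have hq' : (q : ℝ) ≠ 0 := by positivity
  rw [← Real.rpow_natCast]
  congr 1
  push_cast
  field_simp

/-- A resonant coefficient family and its image under the involution have the same sum. -/
theorem finsum_involution_eq {p q : ℕ} (hp : 0 < p) (hq : 0 < q) {a b : ℕ × ℕ → ℝ}
    (ha : ∀ m k : ℕ, a (m, k) ≠ 0 → ∃ u v : ℕ, m = q * u + 1 ∧ k = p * v)
    (hb : ∀ k m : ℕ, b (k, m) ≠ 0 → ∃ u v : ℕ, k = q * v ∧ m = p * u + 1)
    (hab : ∀ u v : ℕ, b (q * v, p * u + 1) = ((q : ℝ) / p) * a (q * u + 1, p * v))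
    (x y : ℝ) :
    ∑ᶠ e : ℕ × ℕ, (p : ℝ) / q * b e *
        (x ^ (1 + (q : ℝ) / p * (e.2 - 1)) * y ^ ((p : ℝ) / q * e.1)) =
      ∑ᶠ e : ℕ × ℕ, a e * x ^ e.1 * y ^ e.2 := by
  have hp' : (p : ℝ) ≠ 0 := by positivity
  have hq' : (q : ℝ) ≠ 0 := by positivity
  have he : Function.Injective fun w : ℕ × ℕ => (q * w.2, p * w.1 + 1) := by
    rintro ⟨u, v⟩ ⟨u', v'⟩ h
    simpa [hp.ne', hq.ne', and_comm] using h
  have he' : Function.Injective fun w : ℕ × ℕ => (q * w.1 + 1, p * w.2) := by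
    rintro ⟨u, v⟩ ⟨u', v'⟩ h
    simpa [hp.ne', hq.ne'] using h
  rw [finsum_eq_finsum_comp_of_support_subset_range he,
    finsum_eq_finsum_comp_of_support_subset_range (f := fun e => a e * x ^ e.1 * y ^ e.2) he']
  · refine finsum_congr fun w => ?_
    rw [hab, rpow_one_add_div_mul hp, rpow_div_mul_natCast hq]
    field_simp
  · rintro ⟨m, k⟩ h
    obtain ⟨u, v, rfl, rfl⟩ := ha m k (left_ne_zero_of_mul (left_ne_zero_of_mul h))
    exact ⟨(u, v), rfl⟩
  · rintro ⟨k, m⟩ h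
    obtain ⟨u, v, rfl, rfl⟩ := hb k m (right_ne_zero_of_mul (left_ne_zero_of_mul h))
    exact ⟨(u, v), rfl⟩

theorem div_mul_rpow_one_sub_mul {c d x : ℝ} (hd : d ≠ 0) (hx : 0 < x) (r : ℝ) :
    c / d * x ^ (1 - r) * (d * x ^ r) = c * x := by
  rw [mul_mul_mul_comm, div_mul_cancel₀ _ hd, ← Real.rpow_add hx, sub_add_cancel, Real.rpow_one]

theorem finsum_swap_monomial (a : ℕ × ℕ → ℝ) (x y : ℝ) :
    ∑ᶠ e : ℕ × ℕ, a e * x ^ e.1 * y ^ e.2 = ∑ᶠ e : ℕ × ℕ, a e.swap * y ^ e.1 * x ^ e.2 := by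
  rw [← finsum_comp_equiv (Equiv.prodComm ℕ ℕ)]
  exact finsum_congr fun e => mul_right_comm _ _ _

/-- Let `p, q` be coprime positive integers with `p ≠ q`.  Consider the `p:-q` resonant
polynomial vector field
`F₁ x y = p·x − Σ_{(m,k)} a_{mk} x^m y^k`, `F₂ x y = −q·y + Σ_{(k,m)} b_{km} x^k y^m`
(with finitely many nonzero real coefficients, all supported in total degree `≥ 2`;
here `a (m,k)` is the coefficient `a_{j k}` with `m = j + 1`, and `b (k,m)` is the
coefficient `b_{k j}` with `m = j + 1`).
The reversibility identities with respect to the involution `φ(x,y) = (y^{p/q}, x^{q/p})`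
hold on the open positive quadrant if and only if:
`a_{jk} = 0` unless `(j,k) = (q·u, p·v)`, `b_{kj} = 0` unless `(k,j) = (q·v, p·u)`,
and `b_{q v, p u} = (q/p)·a_{q u, p v}` for all `u, v ∈ ℕ` with `u + v ≥ 1`. -/
theorem statement0
    (p q : ℕ) (hp : 0 < p) (hq : 0 < q) (hpq : Nat.Coprime p q) (hne : p ≠ q)
    (a b : ℕ × ℕ → ℝ)
    (hafin : (Function.support a).Finite) (hbfin : (Function.support b).Finite)
    (hasupp : ∀ m k : ℕ, a (m, k) ≠ 0 → 2 ≤ m + k)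
    (hbsupp : ∀ k m : ℕ, b (k, m) ≠ 0 → 2 ≤ k + m)
    (F₁ F₂ : ℝ → ℝ → ℝ)
    (hF₁ : ∀ x y : ℝ, F₁ x y = (p : ℝ) * x - ∑ᶠ mk : ℕ × ℕ, a mk * x ^ mk.1 * y ^ mk.2)
    (hF₂ : ∀ x y : ℝ, F₂ x y = -(q : ℝ) * y + ∑ᶠ km : ℕ × ℕ, b km * x ^ km.1 * y ^ km.2) :
    (∀ x y : ℝ, 0 < x → 0 < y →
        ((p : ℝ) / q) * x ^ (1 - (q : ℝ) / p) * F₂ (y ^ ((p : ℝ) / q)) (x ^ ((q : ℝ) / p))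
            = -F₁ x y ∧
        ((q : ℝ) / p) * y ^ (1 - (p : ℝ) / q) * F₁ (y ^ ((p : ℝ) / q)) (x ^ ((q : ℝ) / p))
            = -F₂ x y)
    ↔ ((∀ m k : ℕ, a (m, k) ≠ 0 → ∃ u v : ℕ, m = q * u + 1 ∧ k = p * v) ∧
       (∀ k m : ℕ, b (k, m) ≠ 0 → ∃ u v : ℕ, k = q * v ∧ m = p * u + 1) ∧
       (∀ u v : ℕ, 1 ≤ u + v →
          b (q * v, p * u + 1) = ((q : ℝ) / p) * a (q * u + 1, p * v))) := by
  have hp' : (p : ℝ) ≠ 0 := by positivity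
  have hq' : (q : ℝ) ≠ 0 := by positivity
  constructor
  · intro h
    obtain ⟨h₁, h₂, h₃⟩ := coefficients_of_reversible hp hq hpq hne hafin hbfin
      fun x y hx hy => by
        have := (h x y hx hy).1
        rw [hF₁, hF₂, mul_add, mul_rpow_mul_finsum hx hy] at this
        have hlin := div_mul_rpow_one_sub_mul (c := p) hq' hx ((q : ℝ) / p)
        linarith
    exact ⟨h₁, h₂, fun u v _ => h₃ u v⟩
  · rintro ⟨h₁, h₂, h₃⟩ x y hx hy
    have hab (u v : ℕ) : b (q * v, p * u + 1) = ((q : ℝ) / p) * a (q * u + 1, p * v) := by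
      rcases Nat.eq_zero_or_pos (u + v) with huv | huv
      · obtain ⟨rfl, rfl⟩ : u = 0 ∧ v = 0 := by omega
        have ha : a (1, 0) = 0 := by
          by_contra hc
          exact absurd (hasupp _ _ hc) (by norm_num)
        have hb : b (0, 1) = 0 := by
          by_contra hc
          exact absurd (hbsupp _ _ hc) (by norm_num)
        simp [ha, hb]
      · exact h₃ u v huv
    constructor
    · rw [hF₁, hF₂, mul_add, mul_rpow_mul_finsum hx hy,
        finsum_involution_eq hp hq h₁ h₂ hab]
      have hlin := div_mul_rpow_one_sub_mul (c := p) hq' hx ((q : ℝ) / p)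
      linarith
    · rw [hF₁, hF₂, mul_sub, finsum_swap_monomial a, mul_rpow_mul_finsum hy hx,
        finsum_swap_monomial b,
        finsum_involution_eq (a := fun e => b e.swap) (b := fun e => a e.swap) hq hp
          (fun m k h => ?_) (fun k m h => ?_) (fun u v => ?_)]
      · have hlin := div_mul_rpow_one_sub_mul (c := q) hp' hy ((p : ℝ) / q)
        linarith
      · obtain ⟨u, v, hk, hm⟩ := h₂ k m h
        exact ⟨u, v, hm, hk⟩
      · obtain ⟨u, v, hm, hk⟩ := h₁ m k h
        exact ⟨u, v, hk, hm⟩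
      · simp only [Prod.swap_prod_mk]
        rw [hab]
        field_simp
end

section
/- Let p, q be coprime positive integers with p ≠ q. If the two reversibility identities (p/q)·x^{1−q/p}·F₂(y^{p/q}, x^{q/p}) = −F₁(x,y) and (q/p)·y^{1−p/q}·F₁(y^{p/q}, x^{q/p}) = −F₂(x,y) hold for all real x > 0, y > 0, then F₁(0,y) = 0 for all y and F₂(x,0) = 0 for all x; that is, the coordinate axes x = 0 and y = 0 are invariant lines (separatrices) of the system. -/
/-- A two-variable function which is a polynomial function in each variable separately. -/
def IsSeparatelyPolynomial (F : ℝ → ℝ → ℝ) : Prop :=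
  (∀ y, ∃ P : Polynomial ℝ, ∀ x, F x y = P.eval x) ∧
    ∀ x, ∃ P : Polynomial ℝ, ∀ y, F x y = P.eval y

theorem IsSeparatelyPolynomial.swap {F : ℝ → ℝ → ℝ} (hF : IsSeparatelyPolynomial F) :
    IsSeparatelyPolynomial fun x y => F y x :=
  ⟨hF.2, hF.1⟩

theorem isSeparatelyPolynomial_finsum {c : ℕ × ℕ → ℝ} (hc : (Function.support c).Finite) :
    IsSeparatelyPolynomial fun x y => ∑ᶠ i : ℕ × ℕ, c i * x ^ i.1 * y ^ i.2 := by
  have hsum : ∀ x y : ℝ, ∑ᶠ i : ℕ × ℕ, c i * x ^ i.1 * y ^ i.2 =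
      ∑ i ∈ hc.toFinset, c i * x ^ i.1 * y ^ i.2 := by
    intro x y
    refine finsum_eq_sum_of_support_subset _ fun i hi => ?_
    rw [Set.Finite.coe_toFinset, Function.mem_support]
    intro h
    simp [h] at hi
  refine ⟨fun y => ⟨∑ i ∈ hc.toFinset, Polynomial.C (c i * y ^ i.2) * Polynomial.X ^ i.1, ?_⟩,
    fun x => ⟨∑ i ∈ hc.toFinset, Polynomial.C (c i * x ^ i.1) * Polynomial.X ^ i.2, ?_⟩⟩
  · intro x
    simp only [hsum, Polynomial.eval_finsetSum, Polynomial.eval_mul, Polynomial.eval_C,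
      Polynomial.eval_pow, Polynomial.eval_X]
    exact Finset.sum_congr rfl fun i _ => by ring
  · intro y
    simp [hsum, Polynomial.eval_finsetSum]

theorem Polynomial.eval_eq_zero_of_forall_pos {P : Polynomial ℝ}
    (hP : ∀ x : ℝ, 0 < x → P.eval x = 0) (x : ℝ) : P.eval x = 0 := by
  rw [P.eq_zero_of_infinite_isRoot ((Set.Ioi_infinite (0 : ℝ)).mono hP), Polynomial.eval_zero]

theorem eq_at_zero_of_forall_pos {f g : ℝ → ℝ} (hf : Continuous f) (hg : Continuous g)
    (h : ∀ x, 0 < x → f x = g x) : f 0 = g 0 := by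
  have hcl : Set.EqOn f g (closure (Set.Ioi 0)) :=
    Set.EqOn.closure (fun x hx => h x hx) hf hg
  rw [closure_Ioi] at hcl
  exact hcl Set.self_mem_Ici

/-- Reversibility with respect to `(x, y) ↦ (y ^ α⁻¹, x ^ α)` with `α < 1` forces the coordinate
axes to be invariant. -/
theorem axes_invariant_of_reversible {α : ℝ} (hα : 0 < α) (hα1 : α < 1) {F G : ℝ → ℝ → ℝ}
    (hF : IsSeparatelyPolynomial F) (hG : IsSeparatelyPolynomial G)
    (hFG : ∀ x y : ℝ, 0 < x → 0 < y → α⁻¹ * x ^ (1 - α) * G (y ^ α⁻¹) (x ^ α) = -F x y)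
    (hGF : ∀ x y : ℝ, 0 < x → 0 < y → α * y ^ (1 - α⁻¹) * F (y ^ α⁻¹) (x ^ α) = -G x y) :
    (∀ y, F 0 y = 0) ∧ ∀ x, G x 0 = 0 := by
  have hFpos : ∀ y, 0 < y → F 0 y = 0 := by
    intro y hy
    obtain ⟨P, hP⟩ := hF.1 y
    obtain ⟨Q, hQ⟩ := hG.2 (y ^ α⁻¹)
    have h := eq_at_zero_of_forall_pos
      (f := fun x => α⁻¹ * x ^ (1 - α) * Q.eval (x ^ α)) (g := fun x => -P.eval x)
      ((continuous_const.mul (Real.continuous_rpow_const (by linarith))).mul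
        (Q.continuous.comp (Real.continuous_rpow_const hα.le)))
      P.continuous.neg (fun x hx => by rw [← hQ, ← hP]; exact hFG x y hx hy)
    simp only [Real.zero_rpow (sub_ne_zero.2 hα1.ne'), mul_zero, zero_mul] at h
    rw [hP]
    linarith
  have hGpos : ∀ x, 0 < x → G x 0 = 0 := by
    intro x hx
    obtain ⟨P, hP⟩ := hF.1 (x ^ α)
    obtain ⟨Q, hQ⟩ := hG.2 x
    have hP0 : P.eval 0 = 0 := by rw [← hP, hFpos _ (Real.rpow_pos_of_pos hx α)]
    obtain ⟨R, rfl⟩ : Polynomial.X ∣ P := by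
      rwa [Polynomial.X_dvd_iff, Polynomial.coeff_zero_eq_eval_zero]
    have h := eq_at_zero_of_forall_pos
      (f := fun y => α * y * R.eval (y ^ α⁻¹)) (g := fun y => -Q.eval y)
      ((continuous_const.mul continuous_id).mul
        (R.continuous.comp (Real.continuous_rpow_const (inv_pos.2 hα).le)))
      Q.continuous.neg (fun y hy => by
        have hy' : y ^ (1 - α⁻¹) * y ^ α⁻¹ = y := by
          rw [← Real.rpow_add hy, sub_add_cancel, Real.rpow_one]
        rw [← hQ, ← hGF x y hx hy, hP, Polynomial.eval_mul, Polynomial.eval_X]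
        linear_combination -(α * R.eval (y ^ α⁻¹)) * hy')
    simp only [mul_zero, zero_mul] at h
    rw [hQ]
    linarith
  obtain ⟨P, hP⟩ := hF.2 0
  obtain ⟨Q, hQ⟩ := hG.1 0
  simp only [hP, hQ] at hFpos hGpos ⊢
  exact ⟨Polynomial.eval_eq_zero_of_forall_pos hFpos,
    Polynomial.eval_eq_zero_of_forall_pos hGpos⟩

/-- Let `p, q` be coprime positive integers with `p ≠ q`.  If the `p:-q` resonant
polynomial system
`F₁ x y = p·x − Σ_{(m,k)} a_{mk} x^m y^k`, `F₂ x y = −q·y + Σ_{(k,m)} b_{km} x^k y^m`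
is time-reversible with respect to the involution `φ(x,y) = (y^{p/q}, x^{q/p})`
(i.e. the two componentwise reversibility identities hold for all `x > 0`, `y > 0`),
then `F₁ 0 y = 0` for all `y` and `F₂ x 0 = 0` for all `x`; that is, the coordinate
axes `x = 0` and `y = 0` are invariant lines (separatrices) of the system. -/
theorem statement1
    (p q : ℕ) (hp : 0 < p) (hq : 0 < q) (hpq : Nat.Coprime p q) (hne : p ≠ q)
    (a b : ℕ × ℕ → ℝ)
    (hafin : (Function.support a).Finite) (hbfin : (Function.support b).Finite)
    (hasupp : ∀ m k : ℕ, a (m, k) ≠ 0 → 2 ≤ m + k)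
    (hbsupp : ∀ k m : ℕ, b (k, m) ≠ 0 → 2 ≤ k + m)
    (F₁ F₂ : ℝ → ℝ → ℝ)
    (hF₁ : ∀ x y : ℝ, F₁ x y = (p : ℝ) * x - ∑ᶠ mk : ℕ × ℕ, a mk * x ^ mk.1 * y ^ mk.2)
    (hF₂ : ∀ x y : ℝ, F₂ x y = -(q : ℝ) * y + ∑ᶠ km : ℕ × ℕ, b km * x ^ km.1 * y ^ km.2)
    (hrev : ∀ x y : ℝ, 0 < x → 0 < y →
        ((p : ℝ) / q) * x ^ (1 - (q : ℝ) / p) * F₂ (y ^ ((p : ℝ) / q)) (x ^ ((q : ℝ) / p))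
            = -F₁ x y ∧
        ((q : ℝ) / p) * y ^ (1 - (p : ℝ) / q) * F₁ (y ^ ((p : ℝ) / q)) (x ^ ((q : ℝ) / p))
            = -F₂ x y) :
    (∀ y : ℝ, F₁ 0 y = 0) ∧ (∀ x : ℝ, F₂ x 0 = 0) := by
  have hp' : (0 : ℝ) < p := Nat.cast_pos.2 hp
  have hq' : (0 : ℝ) < q := Nat.cast_pos.2 hq
  have hF : IsSeparatelyPolynomial F₁ := by
    obtain ⟨h₁, h₂⟩ := isSeparatelyPolynomial_finsum hafin
    refine ⟨fun y => ?_, fun x => ?_⟩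
    · obtain ⟨P, hP⟩ := h₁ y
      exact ⟨Polynomial.C (p : ℝ) * Polynomial.X - P, fun x => by simp [hF₁, ← hP]⟩
    · obtain ⟨P, hP⟩ := h₂ x
      exact ⟨Polynomial.C ((p : ℝ) * x) - P, fun y => by simp [hF₁, ← hP]⟩
  have hG : IsSeparatelyPolynomial F₂ := by
    obtain ⟨h₁, h₂⟩ := isSeparatelyPolynomial_finsum hbfin
    refine ⟨fun y => ?_, fun x => ?_⟩
    · obtain ⟨P, hP⟩ := h₁ y
      exact ⟨Polynomial.C (-(q : ℝ) * y) + P, fun x => by simp [hF₂, ← hP]⟩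
    · obtain ⟨P, hP⟩ := h₂ x
      exact ⟨Polynomial.C (-(q : ℝ)) * Polynomial.X + P, fun y => by simp [hF₂, ← hP]⟩
  rcases lt_or_gt_of_ne hne with h | h
  · refine (axes_invariant_of_reversible (α := (p : ℝ) / q) (div_pos hp' hq')
      ((div_lt_one hq').2 (Nat.cast_lt.2 h)) hG.swap hF.swap ?_ ?_).symm
    · intro x y hx hy
      rw [inv_div]
      exact (hrev y x hy hx).2
    · intro x y hx hy
      rw [inv_div]
      exact (hrev y x hy hx).1
  · refine axes_invariant_of_reversible (α := (q : ℝ) / p) (div_pos hq' hp')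
      ((div_lt_one hp').2 (Nat.cast_lt.2 h)) hF hG ?_ ?_
    · intro x y hx hy
      rw [inv_div]
      exact (hrev x y hx hy).1
    · intro x y hx hy
      rw [inv_div]
      exact (hrev x y hx hy).2
end

section
/- Let p, q be coprime positive integers and let h : ℝ → ℝ be an arbitrary function. Define F₁(x,y) = p·x·h(x^q·y^p) and F₂(x,y) = −q·y·h(x^q·y^p). Then for all real x > 0, y > 0 the reversibility identities hold: (p/q)·x^{1−q/p}·F₂(y^{p/q}, x^{q/p}) = −F₁(x,y) and (q/p)·y^{1−p/q}·F₁(y^{p/q}, x^{q/p}) = −F₂(x,y). In particular, every system in Poincaré–Dulac normal form ẋ = p x(1+Σ_k g_k (x^q y^p)^k), ẏ = −q y(1+Σ_k g_k (x^q y^p)^k) is time-reversible with respect to φ(x,y) = (y^{p/q}, x^{q/p}). -/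
theorem Real.rpow_natCast_div_pow {x : ℝ} (hx : 0 ≤ x) (m : ℕ) {n : ℕ} (hn : n ≠ 0) :
    (x ^ ((m : ℝ) / n)) ^ n = x ^ m := by
  rw [← Real.rpow_mul_natCast hx, div_mul_cancel₀ _ (Nat.cast_ne_zero.mpr hn),
    Real.rpow_natCast]

theorem Real.rpow_one_sub_mul_rpow {x : ℝ} (hx : 0 < x) (a : ℝ) :
    x ^ (1 - a) * x ^ a = x := by
  rw [← Real.rpow_add hx, sub_add_cancel, Real.rpow_one]

/-- Let `p, q` be coprime positive integers and `h : ℝ → ℝ` arbitrary.  The vector field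
`F₁ x y = p·x·h(x^q·y^p)`, `F₂ x y = −q·y·h(x^q·y^p)` satisfies, for all `x > 0`,
`y > 0`, the reversibility identities with respect to `φ(x,y) = (y^{p/q}, x^{q/p})`:
`(p/q)·x^{1−q/p}·F₂(y^{p/q}, x^{q/p}) = −F₁(x,y)` and
`(q/p)·y^{1−p/q}·F₁(y^{p/q}, x^{q/p}) = −F₂(x,y)`.
In particular, every system in Poincaré–Dulac normal form
`ẋ = p x(1+Σ_k g_k (x^q y^p)^k)`, `ẏ = −q y(1+Σ_k g_k (x^q y^p)^k)`
is time-reversible with respect to `φ`. -/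
theorem statement2
    (p q : ℕ) (hp : 0 < p) (hq : 0 < q) (hpq : Nat.Coprime p q)
    (h : ℝ → ℝ) (F₁ F₂ : ℝ → ℝ → ℝ)
    (hF₁ : ∀ x y : ℝ, F₁ x y = (p : ℝ) * x * h (x ^ q * y ^ p))
    (hF₂ : ∀ x y : ℝ, F₂ x y = -(q : ℝ) * y * h (x ^ q * y ^ p)) :
    ∀ x y : ℝ, 0 < x → 0 < y →
      ((p : ℝ) / q) * x ^ (1 - (q : ℝ) / p) * F₂ (y ^ ((p : ℝ) / q)) (x ^ ((q : ℝ) / p))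
          = -F₁ x y ∧
      ((q : ℝ) / p) * y ^ (1 - (p : ℝ) / q) * F₁ (y ^ ((p : ℝ) / q)) (x ^ ((q : ℝ) / p))
          = -F₂ x y := by
  intro x y hx hy
  have hp' : (p : ℝ) ≠ 0 := Nat.cast_ne_zero.mpr hp.ne'
  have hq' : (q : ℝ) ≠ 0 := Nat.cast_ne_zero.mpr hq.ne'
  have hinv : (y ^ ((p : ℝ) / q)) ^ q * (x ^ ((q : ℝ) / p)) ^ p = x ^ q * y ^ p := by
    rw [Real.rpow_natCast_div_pow hy.le p hq.ne', Real.rpow_natCast_div_pow hx.le q hp.ne',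
      mul_comm]
  rw [hF₁, hF₂, hF₁, hF₂, hinv]
  generalize h (x ^ q * y ^ p) = c
  constructor
  · calc
      _ = -((p : ℝ) / q * q * (x ^ (1 - (q : ℝ) / p) * x ^ ((q : ℝ) / p)) * c) := by ring
      _ = -((p : ℝ) * x * c) := by
        rw [Real.rpow_one_sub_mul_rpow hx, div_mul_cancel₀ _ hq']
  · calc
      _ = (q : ℝ) / p * p * (y ^ (1 - (p : ℝ) / q) * y ^ ((p : ℝ) / q)) * c := by ring
      _ = -(-(q : ℝ) * y * c) := by
        rw [Real.rpow_one_sub_mul_rpow hy, div_mul_cancel₀ _ hp']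
        ring
end

section
/- Suppose the reversibility condition B(v,u) = (q/p)·A(u,v) holds for all (u,v) ∈ ℕ×ℕ. Then the recursively defined coefficients of the formal series Ψ are symmetric: v(t₁,t₂) = v(t₂,t₁) for all t₁, t₂ ∈ ℕ. (Equivalently, the formal series Ψ is unchanged under the involution φ(x,y) = (y^{p/q}, x^{q/p}).) -/
/-- The recursively defined coefficients `v(t₁,t₂)` of the formal series
`Ψ(x,y) = Σ v(t₁,t₂) x^{q t₁+q} y^{p t₂+p}` attached to the `p:-q` resonant system
`ẋ = x(p − Σ_{u+v≥1} A(u,v) x^{qu} y^{pv})`, `ẏ = −y(q − Σ_{u+v≥1} B(v,u) x^{qv} y^{pu})`: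
`v(0,0) = 1`; `v(t₁,t₂) = 0` if `t₁ = t₂ ≥ 1`; and for `t₁ ≠ t₂`,
`v(t₁,t₂) = (1/(p·q·(t₁−t₂))) · Σ_{0≤s₁≤t₁, 0≤s₂≤t₂, (s₁,s₂)≠(t₁,t₂)}
  [(s₁+1)·q·A(t₁−s₁, t₂−s₂) − (s₂+1)·p·B(t₁−s₁, t₂−s₂)]·v(s₁,s₂)`. -/
noncomputable def vc (p q : ℕ) (A B : ℕ × ℕ → ℂ) (t : ℕ × ℕ) : ℂ :=
  if t.1 = 0 ∧ t.2 = 0 then 1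
  else if t.1 = t.2 then 0
  else (1 / ((p : ℂ) * (q : ℂ) * ((t.1 : ℂ) - (t.2 : ℂ)))) *
    ∑ s ∈ ((Finset.range (t.1 + 1) ×ˢ Finset.range (t.2 + 1)).erase t).attach,
      ((((s : ℕ × ℕ).1 : ℂ) + 1) * (q : ℂ)
          * A (t.1 - (s : ℕ × ℕ).1, t.2 - (s : ℕ × ℕ).2)
        - (((s : ℕ × ℕ).2 : ℂ) + 1) * (p : ℂ)
          * B (t.1 - (s : ℕ × ℕ).1, t.2 - (s : ℕ × ℕ).2))
        * vc p q A B (s : ℕ × ℕ)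
termination_by t.1 + t.2
decreasing_by
  have hmem := s.2
  rw [Finset.mem_erase, Finset.mem_product, Finset.mem_range, Finset.mem_range] at hmem
  obtain ⟨hne, h1, h2⟩ := hmem
  have : ¬((s : ℕ × ℕ).1 = t.1 ∧ (s : ℕ × ℕ).2 = t.2) := by
    rintro ⟨e1, e2⟩
    exact hne (Prod.ext e1 e2)
  omega

theorem vc_of_ne (p q : ℕ) (A B : ℕ × ℕ → ℂ) {t : ℕ × ℕ} (h : t.1 ≠ t.2) :
    vc p q A B t = (1 / ((p : ℂ) * (q : ℂ) * ((t.1 : ℂ) - (t.2 : ℂ)))) *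
      ∑ s ∈ (Finset.range (t.1 + 1) ×ˢ Finset.range (t.2 + 1)).erase t,
        (((s.1 : ℂ) + 1) * (q : ℂ) * A (t.1 - s.1, t.2 - s.2)
          - ((s.2 : ℂ) + 1) * (p : ℂ) * B (t.1 - s.1, t.2 - s.2)) * vc p q A B s := by
  rw [vc, if_neg (fun h0 => h (h0.1.trans h0.2.symm)), if_neg h,
    ← Finset.sum_attach ((Finset.range (t.1 + 1) ×ˢ Finset.range (t.2 + 1)).erase t)]

/-- Under the reversibility condition, `vc` is invariant under swapping its indices. -/
theorem vc_swap (p q : ℕ) (hp : 0 < p) (A B : ℕ × ℕ → ℂ)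
    (hrev : ∀ u v : ℕ, B (v, u) = ((q : ℂ) / (p : ℂ)) * A (u, v)) (t : ℕ × ℕ) :
    vc p q A B t = vc p q A B t.swap := by
  have hpB : ∀ u v : ℕ, (p : ℂ) * B (v, u) = q * A (u, v) := fun u v => by
    have : (p : ℂ) ≠ 0 := Nat.cast_ne_zero.mpr hp.ne'
    rw [hrev]
    field_simp
  by_cases h : t.1 = t.2
  · rw [show t.swap = t from Prod.ext h.symm h]
  rw [vc_of_ne p q A B h, vc_of_ne p q A B (t := t.swap) (Ne.symm h)]
  have key : ∑ s ∈ (Finset.range (t.1 + 1) ×ˢ Finset.range (t.2 + 1)).erase t,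
        (((s.1 : ℂ) + 1) * (q : ℂ) * A (t.1 - s.1, t.2 - s.2)
          - ((s.2 : ℂ) + 1) * (p : ℂ) * B (t.1 - s.1, t.2 - s.2)) * vc p q A B s =
      ∑ s ∈ (Finset.range (t.2 + 1) ×ˢ Finset.range (t.1 + 1)).erase t.swap,
        -((((s.1 : ℂ) + 1) * (q : ℂ) * A (t.2 - s.1, t.1 - s.2)
          - ((s.2 : ℂ) + 1) * (p : ℂ) * B (t.2 - s.1, t.1 - s.2)) * vc p q A B s) := by
    refine Finset.sum_equiv (Equiv.prodComm ℕ ℕ) (fun s => ?_) (fun s hs => ?_)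
    · simp [Prod.ext_iff, and_comm]
    · have hlt : s.1 + s.2 < t.1 + t.2 := by
        simp only [Finset.mem_erase, Finset.mem_product, Finset.mem_range, ne_eq,
          Prod.ext_iff] at hs
        omega
      rw [vc_swap p q hp A B hrev s]
      simp only [Equiv.prodComm_apply, Prod.fst_swap, Prod.snd_swap]
      linear_combination ((-(s.1 : ℂ) - 1) * hpB (t.1 - s.1) (t.2 - s.2)
        + (-(s.2 : ℂ) - 1) * hpB (t.2 - s.2) (t.1 - s.1)) * vc p q A B s.swap
  rw [key, Finset.sum_neg_distrib, Prod.fst_swap, Prod.snd_swap,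
    ← neg_sub (t.2 : ℂ) (t.1 : ℂ), mul_neg, mul_neg, div_neg, neg_mul, neg_neg]
termination_by t.1 + t.2

/-- If the reversibility condition `B(v,u) = (q/p)·A(u,v)` holds for all `(u,v) ∈ ℕ×ℕ`,
then the coefficients of the formal series `Ψ` are symmetric:
`v(t₁,t₂) = v(t₂,t₁)` for all `t₁, t₂ ∈ ℕ` (equivalently, `Ψ` is unchanged under the
involution `φ(x,y) = (y^{p/q}, x^{q/p})`). -/
theorem statement3
    (p q : ℕ) (hp : 0 < p) (hq : 0 < q) (hpq : Nat.Coprime p q)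
    (A B : ℕ × ℕ → ℂ)
    (hrev : ∀ u v : ℕ, B (v, u) = ((q : ℂ) / (p : ℂ)) * A (u, v)) :
    ∀ t₁ t₂ : ℕ, vc p q A B (t₁, t₂) = vc p q A B (t₂, t₁) := by
  exact fun t₁ t₂ => vc_swap p q hp A B hrev (t₁, t₂)
end

section
/- For every ν ∈ M (i.e., every ν ∈ ℕ^{2ℓ} with L(ν) = (qk, pk) for some k ∈ ℕ), θ(κ(ν)·[ν] − [ν̂]) = 0, i.e., θ(κ(ν)·[ν]) = θ([ν̂]). Consequently the Sibirsky ideal I_Sib = ⟨κ(ν)·[ν] − [ν̂] : ν ∈ M⟩ is contained in the kernel of θ. -/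
/-- First component `L₁(ν)` of the linear map
`L(ν) = Σ_{k=1}^ℓ ν_k·(q u_k, p v_k) + Σ_{k=1}^ℓ ν_{2ℓ+1−k}·(q v_k, p u_k)`
(indices `0`-based: position `i < ℓ` carries weight `(q·u i, p·v i)`, position
`i ≥ ℓ` carries weight `(q·v (2ℓ−1−i), p·u (2ℓ−1−i))`). -/
def L1 (l p q : ℕ) (u v : ℕ → ℕ) (ν : Fin (2 * l) → ℕ) : ℕ :=
  ∑ i : Fin (2 * l), ν i * (if (i : ℕ) < l then q * u i else q * v (2 * l - 1 - i))

/-- Second component `L₂(ν)` of the linear map `L`. -/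
def L2 (l p q : ℕ) (u v : ℕ → ℕ) (ν : Fin (2 * l) → ℕ) : ℕ :=
  ∑ i : Fin (2 * l), ν i * (if (i : ℕ) < l then p * v i else p * u (2 * l - 1 - i))

/-- `κ(ν) = (q/p)^{(ν₁+⋯+ν_ℓ)−(ν_{ℓ+1}+⋯+ν_{2ℓ})} ∈ ℚ` (an integer power). -/
noncomputable def kappa (l p q : ℕ) (ν : Fin (2 * l) → ℕ) : ℚ :=
  ((q : ℚ) / (p : ℚ)) ^
    (((∑ i : Fin (2 * l), if (i : ℕ) < l then ν i else 0 : ℕ) : ℤ)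
      - ((∑ i : Fin (2 * l), if l ≤ (i : ℕ) then ν i else 0 : ℕ) : ℤ))

/-- The rational function field `ℚ(γ, t₁, …, t_ℓ)` in `ℓ + 1` variables:
variable `⟨k, _⟩` for `k < ℓ` is `t_{k+1}` and variable `⟨ℓ, _⟩` is `γ`. -/
abbrev RatFuncField (l : ℕ) : Type := FractionRing (MvPolynomial (Fin (l + 1)) ℚ)

/-- The ring homomorphism `θ : ℚ[x₁,…,x_{2ℓ}] → ℚ(γ, t₁,…,t_ℓ)` determined by
`θ(x_k) = t_k` for `1 ≤ k ≤ ℓ` and `θ(x_{2ℓ+1−k}) = (q/p)·γ^{ζ_k}·t_k` for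
`1 ≤ k ≤ ℓ`, where `ζ_k = u_k − v_k ∈ ℤ` and `γ^{ζ_k}` is an integer power
in the fraction field (`0`-based: `θ(x_i) = t_{i+1}` for `i < ℓ`, and for `i ≥ ℓ`,
`θ(x_i) = (q/p)·γ^{ζ_{m+1}}·t_{m+1}` with `m = 2ℓ−1−i`). -/
noncomputable def theta (l p q : ℕ) (u v : ℕ → ℕ) :
    MvPolynomial (Fin (2 * l)) ℚ →ₐ[ℚ] RatFuncField l :=
  MvPolynomial.aeval (fun i : Fin (2 * l) =>
    if h : (i : ℕ) < l then
      algebraMap (MvPolynomial (Fin (l + 1)) ℚ) (RatFuncField l)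
        (MvPolynomial.X ⟨(i : ℕ), by omega⟩)
    else
      ((q : RatFuncField l) / (p : RatFuncField l)) *
        (algebraMap (MvPolynomial (Fin (l + 1)) ℚ) (RatFuncField l)
            (MvPolynomial.X ⟨l, by omega⟩))
          ^ ((u (2 * l - 1 - (i : ℕ)) : ℤ) - (v (2 * l - 1 - (i : ℕ)) : ℤ)) *
        algebraMap (MvPolynomial (Fin (l + 1)) ℚ) (RatFuncField l)
          (MvPolynomial.X ⟨2 * l - 1 - (i : ℕ), by
            have := i.2
            omega⟩))

open MvPolynomial in
/-- The image of the variable in the reversed position differs from `θ(x_i)` by the factor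
`(q/p)^{±1}·γ^{±ζ}`. -/
theorem theta_X_rev (l p q : ℕ) (hp : 0 < p) (hq : 0 < q) (u v : ℕ → ℕ) (i : Fin (2 * l)) :
    theta l p q u v (X i.rev) =
      ((q : RatFuncField l) / (p : RatFuncField l)) ^ (if (i : ℕ) < l then (1 : ℤ) else -1) *
        (algebraMap (MvPolynomial (Fin (l + 1)) ℚ) (RatFuncField l) (X (Fin.last l))) ^
          (if (i : ℕ) < l then (u i : ℤ) - v i
            else (v (2 * l - 1 - i) : ℤ) - u (2 * l - 1 - i)) *
        theta l p q u v (X i) := by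
  have hγ : algebraMap (MvPolynomial (Fin (l + 1)) ℚ) (RatFuncField l) (X (Fin.last l)) ≠ 0 := by
    simp [X_ne_zero]
  have hc : (q : RatFuncField l) / (p : RatFuncField l) ≠ 0 := by
    have : CharZero (RatFuncField l) := algebraRat.charZero _
    exact div_ne_zero (by exact_mod_cast hq.ne') (by exact_mod_cast hp.ne')
  have hi := i.2
  have hrev : (i.rev : ℕ) = 2 * l - 1 - i := by rw [Fin.val_rev]; omega
  have hrev' : 2 * l - 1 - (2 * l - 1 - (i : ℕ)) = i := by omega
  have hlast : (⟨l, Nat.lt_succ_self l⟩ : Fin (l + 1)) = Fin.last l := rfl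
  by_cases h : (i : ℕ) < l
  · have h' : ¬ (2 * l - 1 - (i : ℕ) < l) := by omega
    simp only [theta, aeval_X, hrev, h, h', hrev', dite_true, dite_false, if_true, hlast, zpow_one]
  · have h' : 2 * l - 1 - (i : ℕ) < l := by omega
    simp only [theta, aeval_X, hrev, h, h', dite_true, dite_false, if_false, hlast]
    rw [← neg_sub (u (2 * l - 1 - (i : ℕ)) : ℤ), zpow_neg, zpow_neg, zpow_one]
    have := zpow_ne_zero ((u (2 * l - 1 - (i : ℕ)) : ℤ) - v (2 * l - 1 - (i : ℕ))) hγ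
    generalize (q : RatFuncField l) / (p : RatFuncField l) = c at hc ⊢
    field_simp

/-- If `L(ν)` is a multiple of `(q, p)`, then the exponents of `γ` cancel. -/
theorem sum_mul_zeta_eq_zero (l p q : ℕ) (hp : 0 < p) (hq : 0 < q) (u v : ℕ → ℕ)
    (ν : Fin (2 * l) → ℕ) (k : ℕ) (h1 : L1 l p q u v ν = q * k) (h2 : L2 l p q u v ν = p * k) :
    ∑ i : Fin (2 * l), (if (i : ℕ) < l then (u i : ℤ) - v i
      else (v (2 * l - 1 - i) : ℤ) - u (2 * l - 1 - i)) * (ν i : ℤ) = 0 := by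
  have e1 : ∑ i : Fin (2 * l), ν i * (if (i : ℕ) < l then u i else v (2 * l - 1 - i)) = k := by
    apply Nat.eq_of_mul_eq_mul_left hq
    rw [← h1, L1, Finset.mul_sum]
    refine Finset.sum_congr rfl fun i _ => ?_
    split_ifs <;> ring
  have e2 : ∑ i : Fin (2 * l), ν i * (if (i : ℕ) < l then v i else u (2 * l - 1 - i)) = k := by
    apply Nat.eq_of_mul_eq_mul_left hp
    rw [← h2, L2, Finset.mul_sum]
    refine Finset.sum_congr rfl fun i _ => ?_
    split_ifs <;> ring
  have e : ((∑ i : Fin (2 * l), ν i * (if (i : ℕ) < l then u i else v (2 * l - 1 - i)) : ℕ) : ℤ) -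
      (∑ i : Fin (2 * l), ν i * (if (i : ℕ) < l then v i else u (2 * l - 1 - i)) : ℕ) = 0 := by
    rw [e1, e2, sub_self]
  rw [← e]
  push_cast
  rw [← Finset.sum_sub_distrib]
  refine Finset.sum_congr rfl fun i _ => ?_
  split_ifs <;> ring

theorem kappa_eq_zpow_sum (l p q : ℕ) (ν : Fin (2 * l) → ℕ) :
    kappa l p q ν = ((q : ℚ) / (p : ℚ)) ^
      ∑ i : Fin (2 * l), (if (i : ℕ) < l then (1 : ℤ) else -1) * (ν i : ℤ) := by
  rw [kappa]
  congr 1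
  push_cast
  rw [← Finset.sum_sub_distrib]
  refine Finset.sum_congr rfl fun i _ => ?_
  split_ifs <;> omega

theorem Finset.prod_zpow_eq_zpow_sum₀ {ι K : Type*} [Field K] {a : K} (ha : a ≠ 0)
    (s : Finset ι) (f : ι → ℤ) : ∏ i ∈ s, a ^ f i = a ^ ∑ i ∈ s, f i := by
  classical
  induction s using Finset.induction_on with
  | empty => simp
  | insert i s hi ih => rw [Finset.prod_insert hi, Finset.sum_insert hi, zpow_add₀ ha, ih]

open MvPolynomial in
theorem theta_kappa_mul_sub_rev (l p q : ℕ) (hp : 0 < p) (hq : 0 < q) (u v : ℕ → ℕ)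
    (ν : Fin (2 * l) → ℕ) (k : ℕ) (h1 : L1 l p q u v ν = q * k) (h2 : L2 l p q u v ν = p * k) :
    theta l p q u v
      (C (kappa l p q ν) * ∏ i, (X i : MvPolynomial (Fin (2 * l)) ℚ) ^ ν i
        - ∏ i, (X i : MvPolynomial (Fin (2 * l)) ℚ) ^ ν i.rev) = 0 := by
  have hγ : algebraMap (MvPolynomial (Fin (l + 1)) ℚ) (RatFuncField l) (X (Fin.last l)) ≠ 0 := by
    simp [X_ne_zero]
  have hc : (q : RatFuncField l) / (p : RatFuncField l) ≠ 0 := by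
    have : CharZero (RatFuncField l) := algebraRat.charZero _
    exact div_ne_zero (by exact_mod_cast hq.ne') (by exact_mod_cast hp.ne')
  have hκ : theta l p q u v (C (kappa l p q ν)) = ((q : RatFuncField l) / (p : RatFuncField l)) ^
      ∑ i : Fin (2 * l), (if (i : ℕ) < l then (1 : ℤ) else -1) * (ν i : ℤ) := by
    rw [← algebraMap_eq, AlgHom.commutes, kappa_eq_zpow_sum, map_zpow₀, map_div₀, map_natCast,
      map_natCast]
  have hrev : ∏ i, (X i : MvPolynomial (Fin (2 * l)) ℚ) ^ ν i.rev = ∏ i, X i.rev ^ ν i :=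
    Fintype.prod_equiv Fin.revPerm _ _ fun i => by simp
  rw [map_sub, map_mul, hκ, hrev, map_prod, map_prod, sub_eq_zero]
  simp_rw [map_pow, theta_X_rev l p q hp hq u v, mul_pow, Finset.prod_mul_distrib,
    ← zpow_natCast (_ ^ (_ : ℤ)), ← zpow_mul]
  rw [Finset.prod_zpow_eq_zpow_sum₀ hc, Finset.prod_zpow_eq_zpow_sum₀ hγ,
    sum_mul_zeta_eq_zero l p q hp hq u v ν k h1 h2, zpow_zero, mul_one]

open MvPolynomial in
/-- For every `ν ∈ M` (i.e. every `ν ∈ ℕ^{2ℓ}` with `L(ν) = (qk, pk)` for some `k ∈ ℕ`),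
`θ(κ(ν)·[ν] − [ν̂]) = 0`, i.e. `θ(κ(ν)·[ν]) = θ([ν̂])`.  Consequently the Sibirsky
ideal `I_Sib = ⟨κ(ν)·[ν] − [ν̂] : ν ∈ M⟩` is contained in the kernel of `θ`. -/
theorem statement10
    (l p q : ℕ) (hp : 0 < p) (hq : 0 < q) (hpq : Nat.Coprime p q) (hl : 1 ≤ l)
    (u v : ℕ → ℕ) (huv : ∀ k < l, 1 ≤ u k + v k) :
    (∀ ν : Fin (2 * l) → ℕ,
      (∃ k : ℕ, L1 l p q u v ν = q * k ∧ L2 l p q u v ν = p * k) →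
      theta l p q u v
        (C (kappa l p q ν) * ∏ i, (X i : MvPolynomial (Fin (2 * l)) ℚ) ^ ν i
          - ∏ i, (X i : MvPolynomial (Fin (2 * l)) ℚ) ^ ν i.rev) = 0) ∧
    Ideal.span {f | ∃ ν : Fin (2 * l) → ℕ,
        (∃ k : ℕ, L1 l p q u v ν = q * k ∧ L2 l p q u v ν = p * k) ∧
        f = C (kappa l p q ν) * ∏ i, (X i : MvPolynomial (Fin (2 * l)) ℚ) ^ ν i
              - ∏ i, (X i : MvPolynomial (Fin (2 * l)) ℚ) ^ ν i.rev}
      ≤ RingHom.ker (theta l p q u v) := by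
  have key : ∀ ν : Fin (2 * l) → ℕ,
      (∃ k : ℕ, L1 l p q u v ν = q * k ∧ L2 l p q u v ν = p * k) →
      theta l p q u v
        (C (kappa l p q ν) * ∏ i, (X i : MvPolynomial (Fin (2 * l)) ℚ) ^ ν i
          - ∏ i, (X i : MvPolynomial (Fin (2 * l)) ℚ) ^ ν i.rev) = 0 :=
    fun ν ⟨k, h1, h2⟩ => theta_kappa_mul_sub_rev l p q hp hq u v ν k h1 h2
  refine ⟨key, Ideal.span_le.mpr ?_⟩
  rintro f ⟨ν, hν, rfl⟩
  exact key ν hν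
end

section
/- The Sibirsky ideal equals the kernel of θ: I_Sib = ⟨κ(ν)·[ν] − [ν̂] : ν ∈ M⟩ = ker θ, as ideals of ℚ[x₁,…,x_{2ℓ}]. -/
section BinomialKernel

open MvPolynomial

variable {σ K L G : Type*} [Field K] [CommRing L] [Algebra K L]

/-- If an algebra homomorphism sends every monomial to a nonzero multiple of a member of a linearly
independent family, then its kernel is contained in every ideal containing the binomials that
relate monomials over the same member. -/
theorem ker_le_of_binomials_mem (φ : MvPolynomial σ K →ₐ[K] L) (I : Ideal (MvPolynomial σ K))
    (c : (σ →₀ ℕ) → K) (hc : ∀ α, c α ≠ 0) (g : (σ →₀ ℕ) → G) (w : G → L)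
    (hw : LinearIndependent K w) (hφ : ∀ α, φ (monomial α 1) = algebraMap K L (c α) * w (g α))
    (hI : ∀ α β, g α = g β → C (c β) * monomial α 1 - C (c α) * monomial β 1 ∈ I) :
    RingHom.ker φ ≤ I := by
  classical
  rcases isEmpty_or_nonempty (σ →₀ ℕ) with hE | _
  · exact (hE.false 0).elim
  let s : G → (σ →₀ ℕ) := Function.invFun g
  have hs : ∀ α, g (s (g α)) = g α := fun α => Function.invFun_eq ⟨α, rfl⟩
  let D : MvPolynomial σ K →ₗ[K] (G →₀ K) :=
    (basisMonomials σ K).constr K fun α => Finsupp.single (g α) (c α)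
  let T : (G →₀ K) →ₗ[K] (MvPolynomial σ K ⧸ I) :=
    Finsupp.linearCombination K fun a => (c (s a))⁻¹ • Ideal.Quotient.mkₐ K I (monomial (s a) 1)
  have hD : ∀ α, D (monomial α 1) = Finsupp.single (g α) (c α) := fun α => by
    have := (basisMonomials σ K).constr_basis K (fun α => Finsupp.single (g α) (c α)) α
    simpa [D] using this
  have hTD : T ∘ₗ D = (Ideal.Quotient.mkₐ K I).toLinearMap := by
    refine (basisMonomials σ K).ext fun α => ?_
    have hmem := hI α (s (g α)) (hs α).symm
    rw [← Ideal.Quotient.eq_zero_iff_mem, ← Ideal.Quotient.mkₐ_eq_mk K, map_sub, C_mul', C_mul',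
      map_smul, map_smul, sub_eq_zero] at hmem
    simp only [coe_basisMonomials, LinearMap.comp_apply, hD, T, Finsupp.linearCombination_single,
      AlgHom.toLinearMap_apply]
    rw [smul_comm, ← hmem, inv_smul_smul₀ (hc _)]
  have hwD : Finsupp.linearCombination K w ∘ₗ D = φ.toLinearMap := by
    refine (basisMonomials σ K).ext fun α => ?_
    simp [hD, hφ, Algebra.smul_def]
  intro f hf
  have h0 : D f = 0 := hw (by
    rw [map_zero, ← LinearMap.comp_apply, hwD]
    exact hf)
  rw [← Ideal.Quotient.eq_zero_iff_mem, ← Ideal.Quotient.mkₐ_eq_mk K,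
    ← AlgHom.toLinearMap_apply, ← hTD, LinearMap.comp_apply, h0, map_zero]

end BinomialKernel

section LaurentMonomial

open MvPolynomial

variable {τ : Type*} (K F : Type*) [Field K] [Field F] [Algebra (MvPolynomial τ K) F]

theorem algebraMap_X_ne_zero [IsFractionRing (MvPolynomial τ K) F] (j : τ) :
    algebraMap (MvPolynomial τ K) F (X j) ≠ 0 := by
  simp [X_ne_zero]

variable [Fintype τ]

/-- The Laurent monomial with exponent `e` in a field over a polynomial ring. -/
noncomputable def laurentMonomial (e : τ → ℤ) : F :=
  ∏ j, algebraMap (MvPolynomial τ K) F (X j) ^ e j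

theorem laurentMonomial_add [IsFractionRing (MvPolynomial τ K) F] (e e' : τ → ℤ) :
    laurentMonomial K F (e + e') = laurentMonomial K F e * laurentMonomial K F e' := by
  simp only [laurentMonomial, Pi.add_apply, ← Finset.prod_mul_distrib]
  exact Finset.prod_congr rfl fun j _ => zpow_add₀ (algebraMap_X_ne_zero K F j) _ _

theorem laurentMonomial_natCast (a : τ →₀ ℕ) :
    laurentMonomial K F (fun j => (a j : ℤ))
      = algebraMap (MvPolynomial τ K) F (monomial a 1) := by
  simp [laurentMonomial, monomial_eq, Finsupp.prod_fintype]

theorem linearIndependent_laurentMonomial [IsFractionRing (MvPolynomial τ K) F]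
    [Algebra K F] [IsScalarTower K (MvPolynomial τ K) F] :
    LinearIndependent K (laurentMonomial K F : (τ → ℤ) → F) := by
  classical
  rw [linearIndependent_iff']
  intro s c hsum e he
  let N : ℕ := ∑ d ∈ s, ∑ j, (d j).natAbs
  have hN : ∀ d ∈ s, ∀ j, 0 ≤ d j + N := fun d hd j => by
    have h1 : (d j).natAbs ≤ ∑ j, (d j).natAbs :=
      Finset.single_le_sum (f := fun j => (d j).natAbs) (fun _ _ => Nat.zero_le _)
        (Finset.mem_univ j)
    have h2 : ∑ j, (d j).natAbs ≤ N :=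
      Finset.single_le_sum (f := fun d : τ → ℤ => ∑ j, (d j).natAbs) (fun _ _ => Nat.zero_le _) hd
    omega
  let a : (τ → ℤ) → (τ →₀ ℕ) := fun d => Finsupp.equivFunOnFinite.symm fun j => (d j + N).toNat
  have ha : ∀ d ∈ s, laurentMonomial K F d * laurentMonomial K F (fun _ : τ => (N : ℤ))
      = algebraMap (MvPolynomial τ K) F (monomial (a d) 1) := by
    intro d hd
    rw [← laurentMonomial_add, ← laurentMonomial_natCast]
    congr 1
    funext j
    simp [a, hN d hd j]
  have hpoly : ∑ d ∈ s, c d • (monomial (a d) 1 : MvPolynomial τ K) = 0 := by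
    apply IsFractionRing.injective (MvPolynomial τ K) F
    rw [map_zero, map_sum, ← zero_mul (laurentMonomial K F (fun _ : τ => (N : ℤ))), ← hsum,
      Finset.sum_mul]
    refine Finset.sum_congr rfl fun d hd => ?_
    rw [smul_mul_assoc, ha d hd, ← IsScalarTower.toAlgHom_apply K, map_smul,
      IsScalarTower.toAlgHom_apply]
  have hcoeff := congrArg (coeff (a e)) hpoly
  rw [coeff_sum, Finset.sum_eq_single_of_mem e he] at hcoeff
  · simpa using hcoeff
  · intro d hd hde
    have hne : a d ≠ a e := fun h => hde <| funext fun j => by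
      have hj := DFunLike.congr_fun h j
      have := hN d hd j
      have := hN e he j
      simp only [a, Finsupp.equivFunOnFinite_symm_apply_apply] at hj
      omega
    simp [coeff_monomial, hne]

end LaurentMonomial

/-- The position of `x_k` among the `2 * l` variables. -/
def loIdx {l : ℕ} (k : Fin l) : Fin (2 * l) := ⟨k, by omega⟩

theorem zpow_sum_of_ne_zero {ι F : Type*} [Field F] {a : F} (ha : a ≠ 0) (s : Finset ι)
    (f : ι → ℤ) :
    a ^ (∑ i ∈ s, f i) = ∏ i ∈ s, a ^ f i := by
  classical
  induction s using Finset.induction_on with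
  | empty => simp
  | insert i s hi ih => rw [Finset.sum_insert hi, Finset.prod_insert hi, zpow_add₀ ha, ih]

theorem prod_univ_two_mul {M : Type*} [CommMonoid M] {l : ℕ} (f : Fin (2 * l) → M) :
    ∏ i, f i = ∏ k : Fin l, (f (loIdx k) * f (loIdx k).rev) := by
  have key : ∀ (n : ℕ) (h : n = l + l) (f : Fin n → M), ∏ i, f i
      = ∏ k : Fin l, (f ⟨k, by omega⟩ * f (Fin.rev ⟨k, by omega⟩)) := by
    rintro n rfl f
    rw [Fin.prod_univ_add, Finset.prod_mul_distrib, ← Equiv.prod_comp Fin.revPerm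
      (fun i => f (Fin.natAdd l i))]
    congr 1
    refine Finset.prod_congr rfl fun k _ => congrArg f (Fin.ext ?_)
    simp
    omega
  exact key _ (two_mul l) f

theorem sum_univ_two_mul {M : Type*} [AddCommMonoid M] {l : ℕ} (f : Fin (2 * l) → M) :
    ∑ i, f i = ∑ k : Fin l, (f (loIdx k) + f (loIdx k).rev) :=
  prod_univ_two_mul (M := Multiplicative M) f

theorem loIdx_lt {l : ℕ} (k : Fin l) : (loIdx k : ℕ) < l := k.2

theorem not_rev_loIdx_lt {l : ℕ} (k : Fin l) : ¬ ((loIdx k).rev : ℕ) < l := by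
  simp [Fin.val_rev, loIdx]
  omega

theorem sub_rev_loIdx {l : ℕ} (k : Fin l) : 2 * l - 1 - ((loIdx k).rev : ℕ) = k := by
  simp [Fin.val_rev, loIdx]
  omega

theorem exists_loIdx {l : ℕ} (i : Fin (2 * l)) : ∃ k, i = loIdx k ∨ i = (loIdx k).rev := by
  by_cases h : (i : ℕ) < l
  · exact ⟨⟨i, h⟩, .inl rfl⟩
  · refine ⟨⟨i.rev, by rw [Fin.val_rev]; omega⟩, .inr ?_⟩
    rw [eq_comm, Fin.rev_eq_iff]
    rfl

section Sibirsky

open MvPolynomial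

variable (l p q : ℕ) (u v : ℕ → ℕ)

theorem L1_eq (ν : Fin (2 * l) → ℕ) : L1 l p q u v ν
    = q * ∑ k : Fin l, (ν (loIdx k) * u k + ν (loIdx k).rev * v k) := by
  rw [L1, sum_univ_two_mul, Finset.mul_sum]
  refine Finset.sum_congr rfl fun k _ => ?_
  rw [if_pos (loIdx_lt k), if_neg (not_rev_loIdx_lt k), sub_rev_loIdx]
  simp only [loIdx]
  ring

theorem L2_eq (ν : Fin (2 * l) → ℕ) : L2 l p q u v ν
    = p * ∑ k : Fin l, (ν (loIdx k) * v k + ν (loIdx k).rev * u k) := by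
  rw [L2, sum_univ_two_mul, Finset.mul_sum]
  refine Finset.sum_congr rfl fun k _ => ?_
  rw [if_pos (loIdx_lt k), if_neg (not_rev_loIdx_lt k), sub_rev_loIdx]
  simp only [loIdx]
  ring

theorem kappa_eq (ν : Fin (2 * l) → ℕ) : kappa l p q ν
    = ((q : ℚ) / p) ^ ((∑ k : Fin l, ν (loIdx k) : ℕ) - (∑ k : Fin l, ν (loIdx k).rev : ℕ) : ℤ) := by
  have h1 : (∑ i : Fin (2 * l), if (i : ℕ) < l then ν i else 0) = ∑ k : Fin l, ν (loIdx k) := by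
    rw [sum_univ_two_mul]
    exact Finset.sum_congr rfl fun k _ => by
      rw [if_pos (loIdx_lt k), if_neg (not_rev_loIdx_lt k), add_zero]
  have h2 : (∑ i : Fin (2 * l), if l ≤ (i : ℕ) then ν i else 0)
      = ∑ k : Fin l, ν (loIdx k).rev := by
    rw [sum_univ_two_mul]
    refine Finset.sum_congr rfl fun k _ => ?_
    rw [if_neg (not_le.2 (loIdx_lt k)), if_pos (not_lt.1 (not_rev_loIdx_lt k)), zero_add]
  rw [kappa, h1, h2]

/-- The exponent of `γ` in the image under `theta` of the monomial with exponent `α`. -/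
def gammaExp (α : Fin (2 * l) → ℕ) : ℤ :=
  ∑ k : Fin l, (α (loIdx k).rev : ℤ) * ((u k : ℤ) - v k)

theorem exists_L_eq_iff (hp : 0 < p) (hq : 0 < q) (ν : Fin (2 * l) → ℕ) :
    (∃ k : ℕ, L1 l p q u v ν = q * k ∧ L2 l p q u v ν = p * k)
      ↔ gammaExp l u v (fun i => ν i.rev) = gammaExp l u v ν := by
  have hdiff : ((∑ k : Fin l, (ν (loIdx k) * u k + ν (loIdx k).rev * v k) : ℕ) : ℤ)
      - (∑ k : Fin l, (ν (loIdx k) * v k + ν (loIdx k).rev * u k) : ℕ)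
      = gammaExp l u v (fun i => ν i.rev) - gammaExp l u v ν := by
    simp only [gammaExp, Fin.rev_rev]
    push_cast
    rw [← Finset.sum_sub_distrib, ← Finset.sum_sub_distrib]
    exact Finset.sum_congr rfl fun k _ => by ring
  simp only [L1_eq, L2_eq, Nat.mul_left_cancel_iff hp, Nat.mul_left_cancel_iff hq]
  constructor
  · rintro ⟨k, h1, h2⟩
    rw [h1, h2] at hdiff
    omega
  · intro h
    exact ⟨_, rfl, by omega⟩

/-- The exponent vector of the image under `theta` of the monomial with exponent `α`. -/
def thetaExp (α : Fin (2 * l) → ℕ) : Fin (l + 1) → ℤ :=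
  Fin.snoc (α := fun _ => ℤ) (fun k : Fin l => ((α (loIdx k) + α (loIdx k).rev : ℕ) : ℤ))
    (gammaExp l u v α)

theorem thetaExp_eq_iff (α β : Fin (2 * l) → ℕ) : thetaExp l u v α = thetaExp l u v β ↔
    (∀ k : Fin l, α (loIdx k) + α (loIdx k).rev = β (loIdx k) + β (loIdx k).rev) ∧
      gammaExp l u v α = gammaExp l u v β := by
  rw [funext_iff, Fin.forall_fin_succ']
  simp only [thetaExp, Fin.snoc_castSucc, Fin.snoc_last, Nat.cast_inj]

/-- The coefficient of the image under `theta` of the monomial with exponent `α`. -/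
noncomputable def thetaCoeff (α : Fin (2 * l) → ℕ) : ℚ :=
  ((q : ℚ) / p) ^ (∑ k : Fin l, α (loIdx k).rev)

theorem thetaCoeff_ne_zero (hp : 0 < p) (hq : 0 < q) (α : Fin (2 * l) → ℕ) :
    thetaCoeff l p q α ≠ 0 :=
  pow_ne_zero _ (by positivity)

theorem theta_X_loIdx (k : Fin l) : theta l p q u v (X (loIdx k))
    = algebraMap (MvPolynomial (Fin (l + 1)) ℚ) (RatFuncField l) (X k.castSucc) := by
  rw [theta, aeval_X, dif_pos (loIdx_lt k)]
  rfl

theorem theta_X_rev_loIdx (k : Fin l) : theta l p q u v (X (loIdx k).rev)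
    = algebraMap ℚ (RatFuncField l) ((q : ℚ) / p)
      * algebraMap (MvPolynomial (Fin (l + 1)) ℚ) (RatFuncField l) (X (Fin.last l))
          ^ ((u k : ℤ) - v k)
      * algebraMap (MvPolynomial (Fin (l + 1)) ℚ) (RatFuncField l) (X k.castSucc) := by
  rw [theta, aeval_X, dif_neg (not_rev_loIdx_lt k)]
  simp only [sub_rev_loIdx, map_div₀, map_natCast]
  rfl

theorem theta_prod_X_pow (α : Fin (2 * l) → ℕ) :
    theta l p q u v (∏ i, X i ^ α i)
      = algebraMap ℚ (RatFuncField l) (thetaCoeff l p q α)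
        * laurentMonomial ℚ (RatFuncField l) (thetaExp l u v α) := by
  rw [map_prod, prod_univ_two_mul, laurentMonomial, Fin.prod_univ_castSucc, thetaCoeff, map_pow,
    ← Finset.prod_pow_eq_pow_sum]
  simp only [thetaExp, Fin.snoc_castSucc, Fin.snoc_last, gammaExp, zpow_natCast]
  rw [zpow_sum_of_ne_zero (algebraMap_X_ne_zero ℚ (RatFuncField l) (Fin.last l)),
    ← Finset.prod_mul_distrib,
    ← Finset.prod_mul_distrib]
  refine Finset.prod_congr rfl fun k _ => ?_
  rw [map_pow, map_pow, theta_X_loIdx, theta_X_rev_loIdx, mul_comm ((α _ : ℕ) : ℤ), zpow_mul,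
    zpow_natCast]
  ring

theorem kappa_mul_thetaCoeff (hp : 0 < p) (hq : 0 < q) (ν : Fin (2 * l) → ℕ) :
    kappa l p q ν * thetaCoeff l p q ν = thetaCoeff l p q (fun i => ν i.rev) := by
  have hr : (q : ℚ) / p ≠ 0 := by positivity
  simp only [kappa_eq, thetaCoeff, Fin.rev_rev]
  rw [← zpow_natCast, ← zpow_natCast, ← zpow_add₀ hr, sub_add_cancel]

theorem thetaCoeff_add (α β : Fin (2 * l) → ℕ) :
    thetaCoeff l p q (α + β) = thetaCoeff l p q α * thetaCoeff l p q β := by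
  simp [thetaCoeff, Finset.sum_add_distrib, pow_add]

theorem gammaExp_add (α β : Fin (2 * l) → ℕ) :
    gammaExp l u v (α + β) = gammaExp l u v α + gammaExp l u v β := by
  simp [gammaExp, Finset.sum_add_distrib, add_mul]

/-- Removing the common part of two exponents with the same total degree in each pair of paired
variables leaves exponents that are reversals of each other. -/
theorem exists_add_rev_of_pair_sum_eq {l : ℕ} {α β : Fin (2 * l) → ℕ}
    (h : ∀ k : Fin l, α (loIdx k) + α (loIdx k).rev = β (loIdx k) + β (loIdx k).rev) :
    ∃ μ ν : Fin (2 * l) → ℕ, α = ν + μ ∧ β = (fun i => ν i.rev) + μ := by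
  have h' : ∀ i, α i + α i.rev = β i + β i.rev := fun i => by
    obtain ⟨k, rfl | rfl⟩ := exists_loIdx i
    · exact h k
    · have := h k
      rw [Fin.rev_rev]
      omega
  refine ⟨fun i => min (α i) (β i), fun i => α i - β i, ?_, ?_⟩
  · funext i
    simp only [Pi.add_apply]
    omega
  · funext i
    have := h' i
    simp only [Pi.add_apply]
    omega

end Sibirsky

open MvPolynomial in
/-- The Sibirsky ideal equals the kernel of `θ`:
`I_Sib = ⟨κ(ν)·[ν] − [ν̂] : ν ∈ M⟩ = ker θ` as ideals of `ℚ[x₁,…,x_{2ℓ}]`,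
where `M = {ν ∈ ℕ^{2ℓ} : L(ν) = (qk, pk) for some k ∈ ℕ}`. -/
theorem statement11
    (l p q : ℕ) (hp : 0 < p) (hq : 0 < q) (hpq : Nat.Coprime p q) (hl : 1 ≤ l)
    (u v : ℕ → ℕ) (huv : ∀ k < l, 1 ≤ u k + v k) :
    Ideal.span {f | ∃ ν : Fin (2 * l) → ℕ,
        (∃ k : ℕ, L1 l p q u v ν = q * k ∧ L2 l p q u v ν = p * k) ∧
        f = C (kappa l p q ν) * ∏ i, (X i : MvPolynomial (Fin (2 * l)) ℚ) ^ ν i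
              - ∏ i, (X i : MvPolynomial (Fin (2 * l)) ℚ) ^ ν i.rev}
      = RingHom.ker (theta l p q u v) := by
  have hmon : ∀ α : Fin (2 * l) →₀ ℕ,
      (monomial α 1 : MvPolynomial (Fin (2 * l)) ℚ) = ∏ i, X i ^ α i := fun α => by
    simp [monomial_eq, Finsupp.prod_fintype]
  apply le_antisymm
  · rw [Ideal.span_le]
    rintro _ ⟨ν, hν, rfl⟩
    have hexp : thetaExp l u v (fun i => ν i.rev) = thetaExp l u v ν := by
      rw [thetaExp_eq_iff, ← exists_L_eq_iff l p q u v hp hq]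
      exact ⟨fun k => by rw [Fin.rev_rev, add_comm], hν⟩
    rw [SetLike.mem_coe, RingHom.mem_ker, map_sub, map_mul, ← algebraMap_eq,
      AlgHom.commutes, theta_prod_X_pow, theta_prod_X_pow l p q u v (fun i => ν i.rev), hexp,
      ← mul_assoc, ← map_mul, kappa_mul_thetaCoeff l p q hp hq, sub_self]
  · refine ker_le_of_binomials_mem (theta l p q u v) _ (fun α => thetaCoeff l p q α)
      (fun α => thetaCoeff_ne_zero l p q hp hq α) (fun α => thetaExp l u v α)
      (laurentMonomial ℚ (RatFuncField l)) (linearIndependent_laurentMonomial ℚ (RatFuncField l))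
      (fun α => by rw [hmon, theta_prod_X_pow]) fun α β hαβ => ?_
    obtain ⟨hpair, hgamma⟩ := (thetaExp_eq_iff l u v α β).1 hαβ
    obtain ⟨μ, ν, hα, hβ⟩ := exists_add_rev_of_pair_sum_eq hpair
    rw [hα, hβ, gammaExp_add, gammaExp_add, add_left_inj] at hgamma
    have hν := Ideal.subset_span (α := MvPolynomial (Fin (2 * l)) ℚ)
      (s := {f | ∃ ν : Fin (2 * l) → ℕ,
        (∃ k : ℕ, L1 l p q u v ν = q * k ∧ L2 l p q u v ν = p * k) ∧
        f = C (kappa l p q ν) * ∏ i, (X i : MvPolynomial (Fin (2 * l)) ℚ) ^ ν i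
              - ∏ i, (X i : MvPolynomial (Fin (2 * l)) ℚ) ^ ν i.rev})
      ⟨ν, (exists_L_eq_iff l p q u v hp hq ν).2 hgamma.symm, rfl⟩
    convert Ideal.mul_mem_left _ (C (thetaCoeff l p q α) * ∏ i, X i ^ μ i) hν using 1
    rw [hmon, hmon, hα, hβ, thetaCoeff_add, thetaCoeff_add,
      ← kappa_mul_thetaCoeff l p q hp hq ν]
    simp only [Pi.add_apply, pow_add, Finset.prod_mul_distrib, map_mul]
    ring
end

section
/- The Zariski closure of R in ℂ^{2ℓ} equals the zero locus of ker θ_ℂ; that is, zeroLocus(vanishingIdeal(R)) = zeroLocus(ker θ_ℂ). Here R is the set of parameter tuples of systems of the family that are time-reversible with respect to φ(x,y) = (y^{p/q}, x^{q/p}) after a linear transformation x → αx, y → α⁻¹y with α ∈ ℂ∖{0}. -/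
/-- The rational function field `ℂ(γ, t₁, …, t_ℓ)` in `ℓ + 1` variables:
variable `⟨k, _⟩` for `k < ℓ` is `t_{k+1}` and variable `⟨ℓ, _⟩` is `γ`. -/
abbrev RatFuncFieldC (l : ℕ) : Type := FractionRing (MvPolynomial (Fin (l + 1)) ℂ)

/-- The ring homomorphism `θ_ℂ : ℂ[x₁,…,x_{2ℓ}] → ℂ(γ, t₁,…,t_ℓ)` determined by
`θ_ℂ(x_k) = t_k` for `1 ≤ k ≤ ℓ` and `θ_ℂ(x_{2ℓ+1−k}) = (q/p)·γ^{ζ_k}·t_k` for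
`1 ≤ k ≤ ℓ`, where `ζ_k = u_k − v_k ∈ ℤ` and `γ^{ζ_k}` is an integer power in
the fraction field (`0`-based: `θ_ℂ(x_i) = t_{i+1}` for `i < ℓ`, and for `i ≥ ℓ`,
`θ_ℂ(x_i) = (q/p)·γ^{ζ_{m+1}}·t_{m+1}` with `m = 2ℓ−1−i`). -/
noncomputable def thetaC (l p q : ℕ) (u v : ℕ → ℕ) :
    MvPolynomial (Fin (2 * l)) ℂ →ₐ[ℂ] RatFuncFieldC l :=
  MvPolynomial.aeval (fun i : Fin (2 * l) =>
    if h : (i : ℕ) < l then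
      algebraMap (MvPolynomial (Fin (l + 1)) ℂ) (RatFuncFieldC l)
        (MvPolynomial.X ⟨(i : ℕ), by omega⟩)
    else
      ((q : RatFuncFieldC l) / (p : RatFuncFieldC l)) *
        (algebraMap (MvPolynomial (Fin (l + 1)) ℂ) (RatFuncFieldC l)
            (MvPolynomial.X ⟨l, by omega⟩))
          ^ ((u (2 * l - 1 - (i : ℕ)) : ℤ) - (v (2 * l - 1 - (i : ℕ)) : ℤ)) *
        algebraMap (MvPolynomial (Fin (l + 1)) ℂ) (RatFuncFieldC l)
          (MvPolynomial.X ⟨2 * l - 1 - (i : ℕ), by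
            have := i.2
            omega⟩))

/-- The set `R ⊆ ℂ^{2ℓ}` of parameter tuples of systems in the family which become
time-reversible with respect to the involution `φ(x,y) = (y^{p/q}, x^{q/p})` after a
linear transformation `x → αx`, `y → α⁻¹y` with `α ∈ ℂ∖{0}` (with `γ = α^{−(p+q)}`):
`R = {z : ∃ γ ≠ 0, z_{2ℓ+1−k} = (q/p)·γ^{ζ_k}·z_k for all 1 ≤ k ≤ ℓ}`, where
`ζ_k = u_k − v_k` (`0`-based: coordinate `⟨k, _⟩`, `k < ℓ`, records `a_{k+1}` and
coordinate `⟨2ℓ−1−k, _⟩` records `b_{k+1}`). -/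
def Rset (l p q : ℕ) (u v : ℕ → ℕ) : Set (Fin (2 * l) → ℂ) :=
  {z | ∃ γ : ℂ, γ ≠ 0 ∧ ∀ k : ℕ, ∀ hk : k < l,
    z ⟨2 * l - 1 - k, by omega⟩
      = ((q : ℂ) / (p : ℂ)) * γ ^ ((u k : ℤ) - (v k : ℤ)) * z ⟨k, by omega⟩}

open MvPolynomial in
/-- The fraction `y` is regular where the coordinate `j` does not vanish, with values `F` there:
some `X j ^ N * y` is a polynomial whose values are those of `s j ^ N * F s`. -/
def HasValuesAwayFrom {σ K : Type*} [Field K] (j : σ) (y : FractionRing (MvPolynomial σ K))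
    (F : (σ → K) → K) : Prop :=
  ∃ (N : ℕ) (g : MvPolynomial σ K),
    algebraMap (MvPolynomial σ K) (FractionRing (MvPolynomial σ K)) g
      = algebraMap (MvPolynomial σ K) (FractionRing (MvPolynomial σ K)) (X j) ^ N * y ∧
    ∀ s : σ → K, s j ≠ 0 → eval s g = s j ^ N * F s

namespace HasValuesAwayFrom

open MvPolynomial

variable {σ K : Type*} [Field K] {j : σ} {y z : FractionRing (MvPolynomial σ K)}
  {F G : (σ → K) → K}

theorem of_polynomial (j : σ) (g : MvPolynomial σ K) :
    HasValuesAwayFrom j (algebraMap _ (FractionRing (MvPolynomial σ K)) g)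
      (fun s => eval s g) :=
  ⟨0, g, by simp, by simp⟩

theorem algebraMap_const (j : σ) (a : K) :
    HasValuesAwayFrom j (algebraMap K (FractionRing (MvPolynomial σ K)) a) (fun _ => a) := by
  have := of_polynomial j (C a)
  rw [← algebraMap_eq, ← IsScalarTower.algebraMap_apply] at this
  simpa [algebraMap_eq] using this

theorem natCast_div_natCast (j : σ) (m n : ℕ) :
    HasValuesAwayFrom j
      ((m : FractionRing (MvPolynomial σ K)) / (n : FractionRing (MvPolynomial σ K)))
      (fun _ => (m : K) / (n : K)) := by
  have := algebraMap_const j ((m : K) / (n : K))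
  rwa [map_div₀, map_natCast, map_natCast] at this

theorem add (hy : HasValuesAwayFrom j y F) (hz : HasValuesAwayFrom j z G) :
    HasValuesAwayFrom j (y + z) (fun s => F s + G s) := by
  obtain ⟨N, g, hg, hgF⟩ := hy
  obtain ⟨M, h, hh, hhG⟩ := hz
  refine ⟨N + M, X j ^ M * g + X j ^ N * h, ?_, fun s hs => ?_⟩
  · rw [map_add, map_mul, map_mul, map_pow, map_pow, hg, hh]
    ring
  · rw [map_add, map_mul, map_mul, map_pow, map_pow, hgF s hs, hhG s hs, eval_X]
    ring

theorem mul (hy : HasValuesAwayFrom j y F) (hz : HasValuesAwayFrom j z G) :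
    HasValuesAwayFrom j (y * z) (fun s => F s * G s) := by
  obtain ⟨N, g, hg, hgF⟩ := hy
  obtain ⟨M, h, hh, hhG⟩ := hz
  refine ⟨N + M, g * h, ?_, fun s hs => ?_⟩
  · rw [map_mul, hg, hh]
    ring
  · rw [map_mul, hgF s hs, hhG s hs]
    ring

theorem algebraMap_X_ne_zero (j : σ) :
    algebraMap (MvPolynomial σ K) (FractionRing (MvPolynomial σ K)) (X j) ≠ 0 := by
  rw [Ne, FaithfulSMul.algebraMap_eq_zero_iff]
  exact X_ne_zero j

theorem zpow_X (j : σ) (n : ℤ) :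
    HasValuesAwayFrom j
      (algebraMap (MvPolynomial σ K) (FractionRing (MvPolynomial σ K)) (X j) ^ n)
      (fun s => s j ^ n) := by
  obtain ⟨n, rfl | rfl⟩ := n.eq_nat_or_neg
  · exact ⟨0, X j ^ n, by simp, by simp⟩
  · refine ⟨n, 1, ?_, fun s hs => ?_⟩
    · have := algebraMap_X_ne_zero (K := K) j
      simp [this]
    · simp [hs]

theorem aeval {τ : Type*} {y : τ → FractionRing (MvPolynomial σ K)}
    {F : τ → (σ → K) → K} (h : ∀ i, HasValuesAwayFrom j (y i) (F i)) (f : MvPolynomial τ K) :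
    HasValuesAwayFrom j (MvPolynomial.aeval y f) (fun s => eval (fun i => F i s) f) := by
  induction f using MvPolynomial.induction_on with
  | C a => simpa using algebraMap_const j a
  | add f g hf hg => simpa using hf.add hg
  | mul_X f i hf => simpa using hf.mul (h i)

theorem eq_zero_iff [Infinite K] (h : HasValuesAwayFrom j y F) :
    y = 0 ↔ ∀ s : σ → K, s j ≠ 0 → F s = 0 := by
  obtain ⟨N, g, hg, hgF⟩ := h
  have hX := algebraMap_X_ne_zero (K := K) j
  have hy : y = 0 ↔ g = 0 := by
    rw [← FaithfulSMul.algebraMap_eq_zero_iff (MvPolynomial σ K)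
      (FractionRing (MvPolynomial σ K)), hg]
    simp [hX]
  rw [hy]
  refine ⟨fun h s hs => ?_, fun h => ?_⟩
  · have := hgF s hs
    simpa [h, hs] using this
  · suffices g * X j = 0 from (mul_eq_zero.mp this).resolve_right (X_ne_zero j)
    refine funext fun s => ?_
    by_cases hs : s j = 0
    · simp [hs]
    · simp [hgF s hs, h s hs]

end HasValuesAwayFrom

/-- The parametrization of `Rset` by the values of `t₁, …, t_ℓ, γ`. -/
noncomputable def paramRset (l p q : ℕ) (u v : ℕ → ℕ) (i : Fin (2 * l)) (s : Fin (l + 1) → ℂ) :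
    ℂ :=
  if h : (i : ℕ) < l then s ⟨i, by omega⟩
  else ((q : ℂ) / (p : ℂ)) *
    s ⟨l, by omega⟩ ^ ((u (2 * l - 1 - (i : ℕ)) : ℤ) - (v (2 * l - 1 - (i : ℕ)) : ℤ)) *
      s ⟨2 * l - 1 - (i : ℕ), by omega⟩

theorem mem_Rset_iff_exists_paramRset (l p q : ℕ) (u v : ℕ → ℕ) (w : Fin (2 * l) → ℂ) :
    w ∈ Rset l p q u v ↔
      ∃ s : Fin (l + 1) → ℂ, s ⟨l, by omega⟩ ≠ 0 ∧ (fun i => paramRset l p q u v i s) = w := by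
  constructor
  · rintro ⟨γ, hγ, hw⟩
    refine ⟨fun k => if h : (k : ℕ) < l then w ⟨k, by omega⟩ else γ, by simpa using hγ, ?_⟩
    ext i
    by_cases h : (i : ℕ) < l
    · simp [paramRset, h]
    · have hi := i.2
      have hk : 2 * l - 1 - (i : ℕ) < l := by omega
      have hik : 2 * l - 1 - (2 * l - 1 - (i : ℕ)) = i := by omega
      have := hw _ hk
      simp only [hik, Fin.eta] at this
      simp [paramRset, h, hk, this]
  · rintro ⟨s, hs, rfl⟩
    refine ⟨s ⟨l, by omega⟩, hs, fun k hk => ?_⟩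
    have hk' : ¬ 2 * l - 1 - k < l := by omega
    have hkk : 2 * l - 1 - (2 * l - 1 - k) = k := by omega
    simp [paramRset, hk, hk', hkk]

open MvPolynomial in
theorem hasValuesAwayFrom_thetaC (l p q : ℕ) (u v : ℕ → ℕ) (f : MvPolynomial (Fin (2 * l)) ℂ) :
    HasValuesAwayFrom ⟨l, by omega⟩ (thetaC l p q u v f)
      (fun s => eval (fun i => paramRset l p q u v i s) f) := by
  refine HasValuesAwayFrom.aeval (fun i => ?_) f
  by_cases h : (i : ℕ) < l
  · have key := HasValuesAwayFrom.of_polynomial (⟨l, by omega⟩ : Fin (l + 1))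
      (X (R := ℂ) (⟨i, by omega⟩ : Fin (l + 1)))
    have hF : paramRset l p q u v i = fun s => s ⟨i, by omega⟩ :=
      _root_.funext fun s => dif_pos h
    simp only [eval_X] at key
    rw [hF, dif_pos h]
    exact key
  · have key := ((HasValuesAwayFrom.natCast_div_natCast (K := ℂ)
      (⟨l, by omega⟩ : Fin (l + 1)) q p).mul
      (HasValuesAwayFrom.zpow_X (⟨l, by omega⟩ : Fin (l + 1))
        ((u (2 * l - 1 - (i : ℕ)) : ℤ) - (v (2 * l - 1 - (i : ℕ)) : ℤ)))).mul
      (HasValuesAwayFrom.of_polynomial (⟨l, by omega⟩ : Fin (l + 1))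
        (X (R := ℂ) (⟨2 * l - 1 - (i : ℕ), by omega⟩ : Fin (l + 1))))
    have hF : paramRset l p q u v i = fun s => ((q : ℂ) / (p : ℂ)) *
        s ⟨l, by omega⟩ ^ ((u (2 * l - 1 - (i : ℕ)) : ℤ) - (v (2 * l - 1 - (i : ℕ)) : ℤ)) *
          s ⟨2 * l - 1 - (i : ℕ), by omega⟩ :=
      _root_.funext fun s => dif_neg h
    simp only [eval_X] at key
    rw [hF, dif_neg h]
    exact key

open MvPolynomial in
theorem mem_ker_thetaC_iff (l p q : ℕ) (u v : ℕ → ℕ) (f : MvPolynomial (Fin (2 * l)) ℂ) :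
    f ∈ RingHom.ker (thetaC l p q u v) ↔ ∀ w ∈ Rset l p q u v, eval w f = 0 := by
  rw [RingHom.mem_ker, (hasValuesAwayFrom_thetaC l p q u v f).eq_zero_iff]
  simp only [mem_Rset_iff_exists_paramRset]
  constructor
  · rintro h _ ⟨s, hs, rfl⟩
    exact h s hs
  · exact fun h s hs => h _ ⟨s, hs, rfl⟩

open MvPolynomial in
/-- The Zariski closure of `R` in `ℂ^{2ℓ}` equals the zero locus of `ker θ_ℂ`:
`zeroLocus(vanishingIdeal(R)) = zeroLocus(ker θ_ℂ)`, where `R` is the set of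
parameter tuples of systems of the family that are time-reversible with respect to
`φ(x,y) = (y^{p/q}, x^{q/p})` after a linear transformation `x → αx`, `y → α⁻¹y`
with `α ∈ ℂ∖{0}`. -/
theorem statement12
    (l p q : ℕ) (hp : 0 < p) (hq : 0 < q) (hpq : Nat.Coprime p q) (hl : 1 ≤ l)
    (u v : ℕ → ℕ) (huv : ∀ k < l, 1 ≤ u k + v k) :
    {z : Fin (2 * l) → ℂ | ∀ f : MvPolynomial (Fin (2 * l)) ℂ,
        (∀ w ∈ Rset l p q u v, eval w f = 0) → eval z f = 0}
      = {z : Fin (2 * l) → ℂ |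
          ∀ f ∈ RingHom.ker (thetaC l p q u v), eval z f = 0} := by
  simp only [mem_ker_thetaC_iff]
end

section
/- The zero locus of the Sibirsky ideal is the Zariski closure of the set of time-reversible systems: zeroLocus(I_Sib,ℂ) = zeroLocus(vanishingIdeal(R)), where R is the set of parameter tuples of systems in the family that are time-reversible with respect to φ(x,y) = (y^{p/q}, x^{q/p}) after a linear transformation x → αx, y → α⁻¹y with α ∈ ℂ∖{0}. -/
/-- `κ(ν) = (q/p)^{(ν₁+⋯+ν_ℓ)−(ν_{ℓ+1}+⋯+ν_{2ℓ})}` (an integer power), in `ℂ`. -/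
noncomputable def kappaC (l p q : ℕ) (ν : Fin (2 * l) → ℕ) : ℂ :=
  ((q : ℂ) / (p : ℂ)) ^
    (((∑ i : Fin (2 * l), if (i : ℕ) < l then ν i else 0 : ℕ) : ℤ)
      - ((∑ i : Fin (2 * l), if l ≤ (i : ℕ) then ν i else 0 : ℕ) : ℤ))

namespace Sibirsky

variable {l p q : ℕ}

lemma ratio_ne_zero (hp : 0 < p) (hq : 0 < q) : (q : ℂ) / p ≠ 0 :=
  div_ne_zero (Nat.cast_ne_zero.2 hq.ne') (Nat.cast_ne_zero.2 hp.ne')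

/-- The position of the coefficient `a_{k+1}`; its reversal is the position of `b_{k+1}`. -/
def lo (k : Fin l) : Fin (2 * l) := k.castLE (by omega)

@[simp]
lemma val_lo (k : Fin l) : (lo k : ℕ) = k := rfl

@[simp]
lemma val_rev_lo (k : Fin l) : ((lo k).rev : ℕ) = 2 * l - 1 - k := by
  simp only [Fin.val_rev, val_lo]
  omega

lemma exists_eq_lo_or_rev (i : Fin (2 * l)) : ∃ k : Fin l, i = lo k ∨ i = (lo k).rev := by
  by_cases h : (i : ℕ) < l
  · exact ⟨⟨i, h⟩, Or.inl rfl⟩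
  · refine ⟨⟨2 * l - 1 - i, by omega⟩, Or.inr (Fin.ext ?_)⟩
    simp only [val_rev_lo]
    omega

@[to_additive]
lemma prod_eq_prod_lo_mul_rev {α : Type*} [CommMonoid α] (f : Fin (2 * l) → α) :
    ∏ i, f i = ∏ k : Fin l, (f (lo k) * f (lo k).rev) := by
  have hbij : Function.Bijective (Sum.elim lo (fun k => (lo k).rev) : Fin l ⊕ Fin l → _) := by
    constructor
    · rintro (a | a) (b | b) h <;> have := congrArg Fin.val h <;>
        simp only [Sum.elim_inl, Sum.elim_inr, val_lo, val_rev_lo] at this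
      · exact congrArg _ (Fin.ext this)
      · omega
      · omega
      · exact congrArg _ (Fin.ext (by omega))
    · intro i
      obtain ⟨k, rfl | rfl⟩ := exists_eq_lo_or_rev i
      exacts [⟨.inl k, rfl⟩, ⟨.inr k, rfl⟩]
  rw [← hbij.prod_comp, Fintype.prod_sum_type, Finset.prod_mul_distrib]
  rfl

lemma not_rev_lo_lt (k : Fin l) : ¬ 2 * l - 1 - (k : ℕ) < l := by omega

lemma sub_sub_val (k : Fin l) : 2 * l - 1 - (2 * l - 1 - (k : ℕ)) = k := by omega

lemma kappaC_eq (ν : Fin (2 * l) → ℕ) :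
    kappaC l p q ν = ((q : ℂ) / p) ^ (∑ k : Fin l, ((ν (lo k) : ℤ) - ν (lo k).rev)) := by
  have h₁ (k : Fin l) : l ≤ 2 * l - 1 - (k : ℕ) := by omega
  have h₂ (k : Fin l) : ¬ l ≤ (k : ℕ) := by omega
  simp only [kappaC, sum_eq_sum_lo_add_rev, val_lo, val_rev_lo, h₁, h₂, not_rev_lo_lt,
    Fin.is_lt, if_true, if_false]
  simp

lemma L1_eq (u v : ℕ → ℕ) (ν : Fin (2 * l) → ℕ) :
    L1 l p q u v ν = q * ∑ k : Fin l, (ν (lo k) * u k + ν (lo k).rev * v k) := by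
  simp only [L1, sum_eq_sum_lo_add_rev, val_lo, val_rev_lo, not_rev_lo_lt, sub_sub_val,
    Fin.is_lt, if_true, if_false, Finset.mul_sum]
  exact Finset.sum_congr rfl fun k _ => by ring

lemma L2_eq (u v : ℕ → ℕ) (ν : Fin (2 * l) → ℕ) :
    L2 l p q u v ν = p * ∑ k : Fin l, (ν (lo k) * v k + ν (lo k).rev * u k) := by
  simp only [L2, sum_eq_sum_lo_add_rev, val_lo, val_rev_lo, not_rev_lo_lt, sub_sub_val,
    Fin.is_lt, if_true, if_false, Finset.mul_sum]
  exact Finset.sum_congr rfl fun k _ => by ring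

lemma exists_L_eq_iff (hp : 0 < p) (hq : 0 < q) (u v : ℕ → ℕ) (ν : Fin (2 * l) → ℕ) :
    (∃ k : ℕ, L1 l p q u v ν = q * k ∧ L2 l p q u v ν = p * k) ↔
      ∑ k : Fin l, ((u k : ℤ) - v k) * ν (lo k) =
        ∑ k : Fin l, ((u k : ℤ) - v k) * ν (lo k).rev := by
  have key : (∑ k : Fin l, (ν (lo k) * u k + ν (lo k).rev * v k) =
      ∑ k : Fin l, (ν (lo k) * v k + ν (lo k).rev * u k)) ↔
      ∑ k : Fin l, ((u k : ℤ) - v k) * ν (lo k) =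
        ∑ k : Fin l, ((u k : ℤ) - v k) * ν (lo k).rev := by
    rw [← Nat.cast_inj (R := ℤ), ← sub_eq_zero, ← sub_eq_zero (b := ∑ k : Fin l, _ * _)]
    push_cast
    rw [← Finset.sum_sub_distrib, ← Finset.sum_sub_distrib]
    refine Eq.congr (Finset.sum_congr rfl fun k _ => by ring) rfl
  rw [L1_eq, L2_eq, ← key]
  constructor
  · rintro ⟨k, h₁, h₂⟩
    rw [Nat.eq_of_mul_eq_mul_left hq h₁, Nat.eq_of_mul_eq_mul_left hp h₂]
  · intro h
    exact ⟨_, rfl, by rw [h]⟩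

lemma mem_Rset_iff (u v : ℕ → ℕ) (z : Fin (2 * l) → ℂ) :
    z ∈ Rset l p q u v ↔ ∃ γ : ℂ, γ ≠ 0 ∧ ∀ k : Fin l,
      z (lo k).rev = ((q : ℂ) / p) * γ ^ ((u k : ℤ) - v k) * z (lo k) := by
  have h (k : Fin l) : (lo k).rev = ⟨2 * l - 1 - k, by omega⟩ := Fin.ext (val_rev_lo k)
  simp only [Rset, Set.mem_ofPred_eq, h, Fin.forall_iff]
  rfl

lemma monomial_eq_of_rev {c γ : ℂ} {ζ : Fin l → ℤ} (hγ : γ ≠ 0) {z : Fin (2 * l) → ℂ}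
    (hz : ∀ k : Fin l, z (lo k).rev = c * γ ^ ζ k * z (lo k)) (m : Fin (2 * l) → ℕ) :
    ∏ i, z i ^ m i = c ^ (∑ k : Fin l, m (lo k).rev) *
      (γ ^ (∑ k : Fin l, ζ k * m (lo k).rev) *
        ∏ k : Fin l, z (lo k) ^ (m (lo k) + m (lo k).rev)) := by
  have hsum : γ ^ (∑ k : Fin l, ζ k * m (lo k).rev) =
      ∏ k : Fin l, γ ^ (ζ k * m (lo k).rev) := by
    induction (Finset.univ : Finset (Fin l)) using Finset.induction_on with
    | empty => simp
    | insert a s ha ih => rw [Finset.sum_insert ha, Finset.prod_insert ha, zpow_add₀ hγ, ih]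
  rw [prod_eq_prod_lo_mul_rev, hsum, ← Finset.prod_pow_eq_pow_sum,
    ← Finset.prod_mul_distrib, ← Finset.prod_mul_distrib]
  refine Finset.prod_congr rfl fun k _ => ?_
  rw [hz, mul_pow, mul_pow, zpow_mul, zpow_natCast, pow_add]
  ring

lemma generator_vanishes_on_Rset (hp : 0 < p) (hq : 0 < q) {u v : ℕ → ℕ} {z : Fin (2 * l) → ℂ}
    (hz : z ∈ Rset l p q u v) {ν : Fin (2 * l) → ℕ}
    (hν : ∑ k : Fin l, ((u k : ℤ) - v k) * ν (lo k) =
      ∑ k : Fin l, ((u k : ℤ) - v k) * ν (lo k).rev) :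
    kappaC l p q ν * ∏ i, z i ^ ν i = ∏ i, z i ^ ν i.rev := by
  obtain ⟨γ, hγ, h⟩ := (mem_Rset_iff u v z).1 hz
  have hc : (q : ℂ) / p ≠ 0 := ratio_ne_zero hp hq
  rw [kappaC_eq, monomial_eq_of_rev hγ h ν, monomial_eq_of_rev hγ h fun i => ν i.rev]
  simp only [Fin.rev_rev, hν, add_comm (ν (lo _).rev)]
  rw [← mul_assoc, ← zpow_natCast, ← zpow_natCast, ← zpow_add₀ hc]
  simp

/-- Two monomials with the same restriction to `R`, up to their scalar factors, agree up to the
same factors on the zero locus of the Sibirsky ideal. -/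
lemma monomial_eq_of_sibirsky (hp : 0 < p) (hq : 0 < q) {ζ : Fin l → ℤ} {z : Fin (2 * l) → ℂ}
    (hz : ∀ ν : Fin (2 * l) → ℕ,
      ∑ k : Fin l, ζ k * ν (lo k) = ∑ k : Fin l, ζ k * ν (lo k).rev →
      kappaC l p q ν * ∏ i, z i ^ ν i = ∏ i, z i ^ ν i.rev)
    {m m' : Fin (2 * l) → ℕ}
    (hs : ∀ k : Fin l, m (lo k) + m (lo k).rev = m' (lo k) + m' (lo k).rev)
    (hd : ∑ k : Fin l, ζ k * m (lo k).rev = ∑ k : Fin l, ζ k * m' (lo k).rev) :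
    (∏ i, z i ^ m i) / ((q : ℂ) / p) ^ (∑ k : Fin l, m (lo k).rev) =
      (∏ i, z i ^ m' i) / ((q : ℂ) / p) ^ (∑ k : Fin l, m' (lo k).rev) := by
  have hc : (q : ℂ) / p ≠ 0 := ratio_ne_zero hp hq
  have hdiff (k : Fin l) : ((m (lo k) - m' (lo k) : ℕ) : ℤ) -
      ((m (lo k).rev - m' (lo k).rev : ℕ) : ℤ) = m' (lo k).rev - m (lo k).rev := by
    have := hs k
    omega
  have hrev (i : Fin (2 * l)) : m i.rev - m' i.rev = m' i - m i := by
    obtain ⟨k, rfl | rfl⟩ := exists_eq_lo_or_rev i <;> have := hs k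
    · omega
    · rw [Fin.rev_rev]
      omega
  have h := hz (fun i => m i - m' i) (by
    rw [← sub_eq_zero, ← Finset.sum_sub_distrib]
    simp only [← mul_sub, hdiff]
    simp only [mul_sub, Finset.sum_sub_distrib, hd, sub_self])
  simp only [kappaC_eq, hdiff] at h
  simp only [hrev, Finset.sum_sub_distrib] at h
  rw [zpow_sub₀ hc, ← Nat.cast_sum, ← Nat.cast_sum, zpow_natCast, zpow_natCast] at h
  have hm : ∏ i, z i ^ m i = (∏ i, z i ^ min (m i) (m' i)) * ∏ i, z i ^ (m i - m' i) := by
    rw [← Finset.prod_mul_distrib]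
    refine Finset.prod_congr rfl fun i _ => ?_
    rw [← pow_add]
    congr 1
    omega
  have hm' : ∏ i, z i ^ m' i = (∏ i, z i ^ min (m i) (m' i)) * ∏ i, z i ^ (m' i - m i) := by
    rw [← Finset.prod_mul_distrib]
    refine Finset.prod_congr rfl fun i _ => ?_
    rw [← pow_add]
    congr 1
    omega
  rw [hm, hm', ← h]
  field_simp

/-- The character `(γ, a) ↦ γ ^ d * ∏ k, a k ^ s k` of the torus `ℂˣ × (ℂˣ)^l`. -/
def torusCharacter (e : ℤ × (Fin l → ℕ)) : ℂˣ × (Fin l → ℂˣ) →* ℂ :=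
  (Units.coeHom ℂ).comp
    { toFun := fun g => g.1 ^ e.1 * ∏ k, g.2 k ^ e.2 k
      map_one' := by simp
      map_mul' := fun g h => by
        simp only [Prod.fst_mul, Prod.snd_mul, Pi.mul_apply, mul_zpow, mul_pow,
          Finset.prod_mul_distrib]
        exact mul_mul_mul_comm _ _ _ _ }

lemma torusCharacter_apply (e : ℤ × (Fin l → ℕ)) (g : ℂˣ × (Fin l → ℂˣ)) :
    torusCharacter e g = (g.1 : ℂ) ^ e.1 * ∏ k, (g.2 k : ℂ) ^ e.2 k := by
  simp [torusCharacter]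

lemma torusCharacter_injective : Function.Injective (torusCharacter (l := l)) := by
  intro e e' h
  have hpow : Function.Injective fun n : ℤ => (2 : ℝ) ^ n :=
    zpow_right_injective₀ two_pos (by norm_num)
  refine Prod.ext ?_ (funext fun k => ?_)
  · have := DFunLike.congr_fun h (Units.mk0 2 two_ne_zero, 1)
    simp only [torusCharacter_apply, Units.val_mk0, Pi.one_apply, Units.val_one, one_pow,
      Finset.prod_const_one, mul_one] at this
    exact hpow (Complex.ofReal_injective (by push_cast; exact this))
  · have := DFunLike.congr_fun h (1, Pi.mulSingle k (Units.mk0 2 two_ne_zero))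
    simp only [torusCharacter_apply, Units.val_one, one_zpow, one_mul] at this
    rw [Fintype.prod_eq_single k, Fintype.prod_eq_single k] at this
    · simp only [Pi.mulSingle_eq_same, Units.val_mk0] at this
      exact Nat.pow_right_injective le_rfl (by beta_reduce; exact_mod_cast this)
    all_goals
      intro j hj
      simp [Pi.mulSingle_eq_of_ne hj]

lemma sum_fiber_eq_zero {ι : Type*} {s : Finset ι} {a : ι → ℂ} {D : ι → ℤ × (Fin l → ℕ)}
    (h : ∀ g, ∑ m ∈ s, a m * torusCharacter (D m) g = 0) :
    ∀ e ∈ s.image D, ∑ m ∈ s with D m = e, a m = 0 := by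
  have hli := (linearIndependent_monoidHom (ℂˣ × (Fin l → ℂˣ)) ℂ).comp _ torusCharacter_injective
  refine linearIndependent_iff'.1 hli _ (fun e => ∑ m ∈ s with D m = e, a m) ?_
  funext g
  simp only [Finset.sum_apply, Pi.smul_apply, Function.comp_apply, smul_eq_mul, Pi.zero_apply]
  rw [← h g, ← Finset.sum_fiberwise_of_maps_to fun m hm => Finset.mem_image_of_mem D hm]
  refine Finset.sum_congr rfl fun e _ => ?_
  rw [Finset.sum_mul]
  exact Finset.sum_congr rfl fun m hm => by rw [(Finset.mem_filter.1 hm).2]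

lemma exists_mem_Rset_of_torus (u v : ℕ → ℕ) (g : ℂˣ × (Fin l → ℂˣ)) :
    ∃ w ∈ Rset l p q u v, ∀ m : Fin (2 * l) → ℕ,
      ∏ i, w i ^ m i = ((q : ℂ) / p) ^ (∑ k : Fin l, m (lo k).rev) *
        torusCharacter (∑ k : Fin l, ((u k : ℤ) - v k) * m (lo k).rev,
          fun k => m (lo k) + m (lo k).rev) g := by
  let w : Fin (2 * l) → ℂ := fun i =>
    if h : (i : ℕ) < l then g.2 ⟨i, h⟩
    else (q : ℂ) / p * (g.1 : ℂ) ^ ((u i.rev : ℤ) - v i.rev) * g.2 ⟨i.rev, by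
      rw [Fin.val_rev]; omega⟩
  have hlo (k : Fin l) : w (lo k) = g.2 k := by simp [w]
  have hw (k : Fin l) :
      w (lo k).rev = (q : ℂ) / p * (g.1 : ℂ) ^ ((u k : ℤ) - v k) * w (lo k) := by
    rw [hlo]
    simp only [w, Fin.rev_rev, val_rev_lo, not_rev_lo_lt, dite_false, val_lo]
  refine ⟨w, (mem_Rset_iff u v w).2 ⟨g.1, g.1.ne_zero, hw⟩, fun m => ?_⟩
  rw [monomial_eq_of_rev g.1.ne_zero hw, torusCharacter_apply]
  simp only [hlo]

open MvPolynomial in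
lemma eval_eq_zero_of_sibirsky (hp : 0 < p) (hq : 0 < q) {u v : ℕ → ℕ} {z : Fin (2 * l) → ℂ}
    (hz : ∀ ν : Fin (2 * l) → ℕ,
      ∑ k : Fin l, ((u k : ℤ) - v k) * ν (lo k) =
        ∑ k : Fin l, ((u k : ℤ) - v k) * ν (lo k).rev →
      kappaC l p q ν * ∏ i, z i ^ ν i = ∏ i, z i ^ ν i.rev)
    {f : MvPolynomial (Fin (2 * l)) ℂ} (hf : ∀ w ∈ Rset l p q u v, eval w f = 0) :
    eval z f = 0 := by
  let D (m : Fin (2 * l) →₀ ℕ) : ℤ × (Fin l → ℕ) :=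
    (∑ k : Fin l, ((u k : ℤ) - v k) * m (lo k).rev, fun k => m (lo k) + m (lo k).rev)
  let c (m : Fin (2 * l) →₀ ℕ) : ℂ := ((q : ℂ) / p) ^ (∑ k : Fin l, m (lo k).rev)
  have hc (m) : c m ≠ 0 := pow_ne_zero _ (ratio_ne_zero hp hq)
  have hfiber : ∀ e ∈ f.support.image D, ∑ m ∈ f.support with D m = e, coeff m f * c m = 0 := by
    refine sum_fiber_eq_zero fun g => ?_
    obtain ⟨w, hwR, hw⟩ := exists_mem_Rset_of_torus (p := p) (q := q) u v g
    rw [← hf w hwR, eval_eq']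
    refine Finset.sum_congr rfl fun m _ => ?_
    rw [hw, mul_assoc]
  rw [eval_eq', ← Finset.sum_fiberwise_of_maps_to fun m hm => Finset.mem_image_of_mem D hm]
  refine Finset.sum_eq_zero fun e he => ?_
  obtain ⟨m₀, -, rfl⟩ := Finset.mem_image.1 he
  calc ∑ m ∈ f.support with D m = D m₀, coeff m f * ∏ i, z i ^ m i
      = ∑ m ∈ f.support with D m = D m₀, coeff m f * c m * ((∏ i, z i ^ m₀ i) / c m₀) := by
        refine Finset.sum_congr rfl fun m hm => ?_
        have hD := (Finset.mem_filter.1 hm).2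
        have h := monomial_eq_of_sibirsky hp hq hz (m := m) (m' := m₀)
          (fun k => congrFun (congrArg Prod.snd hD) k) (congrArg Prod.fst hD)
        rw [← h, mul_assoc, mul_div_cancel₀ _ (hc m)]
    _ = 0 := by rw [← Finset.sum_mul, hfiber _ he, zero_mul]

end Sibirsky

open MvPolynomial in
/-- The zero locus of the (complex) Sibirsky ideal
`I_Sib,ℂ = ⟨κ(ν)·[ν] − [ν̂] : ν ∈ M⟩` (where `[ν] = ∏ᵢ xᵢ^{νᵢ}` and
`M = {ν : L(ν) = (qk,pk) for some k}`) is the Zariski closure of the set `R` of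
time-reversible systems: `zeroLocus(I_Sib,ℂ) = zeroLocus(vanishingIdeal(R))`. -/
theorem statement14
    (l p q : ℕ) (hp : 0 < p) (hq : 0 < q) (hpq : Nat.Coprime p q) (hl : 1 ≤ l)
    (u v : ℕ → ℕ) (huv : ∀ k < l, 1 ≤ u k + v k) :
    {z : Fin (2 * l) → ℂ |
        ∀ f ∈ Ideal.span {f : MvPolynomial (Fin (2 * l)) ℂ | ∃ ν : Fin (2 * l) → ℕ,
          (∃ k : ℕ, L1 l p q u v ν = q * k ∧ L2 l p q u v ν = p * k) ∧
          f = C (kappaC l p q ν) * ∏ i, (X i : MvPolynomial (Fin (2 * l)) ℂ) ^ ν i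
                - ∏ i, (X i : MvPolynomial (Fin (2 * l)) ℂ) ^ ν i.rev},
          eval z f = 0}
      = {z : Fin (2 * l) → ℂ | ∀ f : MvPolynomial (Fin (2 * l)) ℂ,
          (∀ w ∈ Rset l p q u v, eval w f = 0) → eval z f = 0} := by
  ext z
  simp only [Set.mem_ofPred_eq]
  constructor
  · intro hz f hf
    refine Sibirsky.eval_eq_zero_of_sibirsky hp hq (fun ν hν => ?_) hf
    have h := hz _ (Ideal.subset_span
      ⟨ν, (Sibirsky.exists_L_eq_iff hp hq u v ν).2 hν, rfl⟩)
    simpa [eval_prod, sub_eq_zero] using h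
  · intro hz f hf
    refine hz f fun w hw => ?_
    rw [← RingHom.mem_ker]
    refine Ideal.span_le.2 ?_ hf
    rintro _ ⟨ν, hν, rfl⟩
    have h := Sibirsky.generator_vanishes_on_Rset hp hq hw
      ((Sibirsky.exists_L_eq_iff hp hq u v ν).1 hν)
    simpa [RingHom.mem_ker, eval_prod, sub_eq_zero] using h
end

section
/- Consider the 1:−2 resonant quintic family ẋ = x − a₀₁xy − a₂₀x³ − a₂₁x³y − a₀₂xy² − a₄₀x⁵, ẏ = −2y + b₀₁y² + b₂₀x²y + b₂₁x²y² + b₀₂y³ + b₄₀x⁴y. If the ten coefficients (a₀₁, a₂₀, a₀₂, a₄₀, a₂₁, b₂₁, b₄₀, b₀₂, b₂₀, b₀₁) ∈ ℂ¹⁰ satisfy the nine equations 2a₂₁ − b₂₁ = 0, a₄₀b₀₁² − 2a₂₀²b₀₂ = 0, 4a₀₂a₄₀ − b₀₂b₄₀ = 0, 8a₀₂a₂₀² − b₀₁²b₄₀ = 0, 2a₀₂a₂₀b₂₀ − a₀₁b₀₁b₄₀ = 0, 2a₀₁a₄₀b₀₁ − a₂₀b₀₂b₂₀ = 0, 4a₀₁a₂₀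 − b₀₁b₂₀ = 0, a₀₂b₂₀² − 2a₀₁²b₄₀ = 0, 8a₀₁²a₄₀ − b₀₂b₂₀² = 0, then all saddle quantities of the system vanish: G(k) = 0 for every k ≥ 1, so the system admits an analytic first integral of the form x²y + higher order terms. -/
/-- The `k`-th saddle quantity
`G(k) = Σ_{0≤s₁≤k, 0≤s₂≤k, (s₁,s₂)≠(k,k)}
  [(s₁+1)·q·A(k−s₁, k−s₂) − (s₂+1)·p·B(k−s₁, k−s₂)]·v(s₁,s₂)`. -/
noncomputable def G (p q : ℕ) (A B : ℕ × ℕ → ℂ) (k : ℕ) : ℂ :=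
  ∑ s ∈ (Finset.range (k + 1) ×ˢ Finset.range (k + 1)).erase (k, k),
    (((s.1 : ℂ) + 1) * (q : ℂ) * A (k - s.1, k - s.2)
      - ((s.2 : ℂ) + 1) * (p : ℂ) * B (k - s.1, k - s.2)) * vc p q A B s

/-- The sum occurring in the recursion for `vc 1 2 A B t`; on the diagonal it is `G 1 2 A B`. -/
noncomputable def recSum (A B : ℕ × ℕ → ℂ) (t : ℕ × ℕ) : ℂ :=
  ∑ s ∈ (Finset.range (t.1 + 1) ×ˢ Finset.range (t.2 + 1)).erase t,
    (((s.1 : ℂ) + 1) * (2 : ℕ) * A (t.1 - s.1, t.2 - s.2)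
      - ((s.2 : ℂ) + 1) * (1 : ℕ) * B (t.1 - s.1, t.2 - s.2)) * vc 1 2 A B s

theorem vc_diag {A B : ℕ × ℕ → ℂ} {n : ℕ} (hn : n ≠ 0) : vc 1 2 A B (n, n) = 0 := by
  rw [vc]; simp [hn]

theorem vc_of_ne_s15 {A B : ℕ × ℕ → ℂ} {m n : ℕ} (h : m ≠ n) :
    vc 1 2 A B (m, n) = 1 / (2 * ((m : ℂ) - n)) * recSum A B (m, n) := by
  have h0 : ¬(m = 0 ∧ n = 0) := by omega
  have hS := Finset.sum_attach ((Finset.range (m + 1) ×ˢ Finset.range (n + 1)).erase (m, n))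
    fun s => (((s.1 : ℂ) + 1) * (2 : ℕ) * A (m - s.1, n - s.2)
      - ((s.2 : ℂ) + 1) * (1 : ℕ) * B (m - s.1, n - s.2)) * vc 1 2 A B s
  rw [vc, recSum, ← hS, if_neg h0, if_neg h, Nat.cast_one, one_mul, Nat.cast_ofNat]

theorem G_eq_recSum (A B : ℕ × ℕ → ℂ) (k : ℕ) : G 1 2 A B k = recSum A B (k, k) := rfl

theorem mem_recSum_index {m n a b : ℕ}
    (h : (a, b) ∈ (Finset.range (m + 1) ×ˢ Finset.range (n + 1)).erase (m, n)) :
    a ≤ m ∧ b ≤ n ∧ a + b < m + n := by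
  simp only [Finset.mem_erase, Finset.mem_product, Finset.mem_range, ne_eq, Prod.mk.injEq] at h
  omega

section Reversible

variable {A B : ℕ × ℕ → ℂ} {l : ℂ}

theorem recSum_swap (h : ∀ u v, 2 * A (u, v) * l ^ u = B (v, u) * l ^ v) {m n : ℕ}
    (ih : ∀ a b, a + b < m + n → l ^ a * vc 1 2 A B (a, b) = l ^ b * vc 1 2 A B (b, a)) :
    l ^ m * recSum A B (m, n) = -(l ^ n * recSum A B (n, m)) := by
  rw [recSum, recSum, Finset.mul_sum, Finset.mul_sum, ← Finset.sum_neg_distrib]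
  refine Finset.sum_bij' (fun s _ => s.swap) (fun s _ => s.swap) ?_ ?_ ?_ ?_ ?_
  · rintro ⟨a, b⟩ hs
    simp only [Finset.mem_erase, Finset.mem_product, Finset.mem_range, ne_eq, Prod.mk.injEq,
      Prod.swap_prod_mk] at hs ⊢
    omega
  · rintro ⟨a, b⟩ hs
    simp only [Finset.mem_erase, Finset.mem_product, Finset.mem_range, ne_eq, Prod.mk.injEq,
      Prod.swap_prod_mk] at hs ⊢
    omega
  · simp
  · simp
  · rintro ⟨a, b⟩ hs
    obtain ⟨ha, hb, hab⟩ := mem_recSum_index hs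
    obtain ⟨u, rfl⟩ := Nat.exists_eq_add_of_le ha
    obtain ⟨v, rfl⟩ := Nat.exists_eq_add_of_le hb
    have e := ih a b hab
    have huv := h u v
    have hvu := h v u
    simp only [Prod.swap_prod_mk, Nat.add_sub_cancel_left, pow_add]
    push_cast
    linear_combination (((a : ℂ) + 1) * 2 * A (u, v) - (b + 1) * B (u, v)) * l ^ u * e
      + (a + 1) * l ^ b * vc 1 2 A B (b, a) * huv + (b + 1) * l ^ b * vc 1 2 A B (b, a) * hvu

theorem vc_swap_s15 (h : ∀ u v, 2 * A (u, v) * l ^ u = B (v, u) * l ^ v) (m n : ℕ) :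
    l ^ m * vc 1 2 A B (m, n) = l ^ n * vc 1 2 A B (n, m) := by
  by_cases hmn : m = n
  · rw [hmn]
  · have ih : ∀ a b, a + b < m + n →
        l ^ a * vc 1 2 A B (a, b) = l ^ b * vc 1 2 A B (b, a) := fun a b _ => vc_swap_s15 h a b
    have e := recSum_swap h ih
    have hneg : 1 / (2 * ((n : ℂ) - m)) = -(1 / (2 * ((m : ℂ) - n))) := by
      rw [← neg_sub (m : ℂ), mul_neg, div_neg]
    rw [vc_of_ne_s15 hmn, vc_of_ne_s15 (Ne.symm hmn), hneg]
    linear_combination (1 / (2 * ((m : ℂ) - n))) * e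
termination_by m + n

theorem G_eq_zero_of_reversible (hl : l ≠ 0)
    (h : ∀ u v, 2 * A (u, v) * l ^ u = B (v, u) * l ^ v) (k : ℕ) : G 1 2 A B k = 0 := by
  have e := recSum_swap h (m := k) (n := k) fun a b _ => vc_swap_s15 h a b
  rw [← G_eq_recSum, self_eq_neg] at e
  exact (mul_eq_zero.mp e).resolve_left (pow_ne_zero k hl)

end Reversible

section Triangular

variable {A B : ℕ × ℕ → ℂ} {c : ℤ}

theorem vc_eq_zero_of_triangular
    (h : ∀ u v : ℕ, 0 < c * (u - v) → A (u, v) = 0 ∧ B (u, v) = 0)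
    (m n : ℕ) (hmn : 0 < c * (m - n)) : vc 1 2 A B (m, n) = 0 := by
  have hne : m ≠ n := by rintro rfl; simp at hmn
  rw [vc_of_ne_s15 hne, recSum, Finset.sum_eq_zero, mul_zero]
  rintro ⟨a, b⟩ hs
  obtain ⟨ha, hb, hab⟩ := mem_recSum_index hs
  by_cases hc : 0 < c * ((a : ℤ) - b)
  · rw [vc_eq_zero_of_triangular h a b hc, mul_zero]
  · have := h (m - a) (n - b) (by push_cast [ha, hb]; linarith)
    simp [this]
termination_by m + n

theorem G_eq_zero_of_triangular (hc : c ≠ 0)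
    (h : ∀ u v : ℕ, 0 < c * (u - v) → A (u, v) = 0 ∧ B (u, v) = 0)
    (hd : ∀ u, 2 * A (u, u) = B (u, u)) (k : ℕ) : G 1 2 A B k = 0 := by
  rw [G_eq_recSum, recSum]
  refine Finset.sum_eq_zero ?_
  rintro ⟨a, b⟩ hs
  obtain ⟨ha, hb, hab⟩ := mem_recSum_index hs
  rcases lt_trichotomy 0 (c * ((a : ℤ) - b)) with hlt | heq | hgt
  · rw [vc_eq_zero_of_triangular h a b hlt, mul_zero]
  · have hab : a = b := by
      have := (mul_eq_zero.mp heq.symm).resolve_left hc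
      omega
    subst hab
    simp only [← hd]
    push_cast
    ring
  · have := h (k - a) (k - b) (by push_cast [ha, hb]; linarith)
    simp [this]

end Triangular

/-- The points of the toric variety with parametrization `p₁ = l q₁`, `p₂ = l q₂`, `p₃ = l² q₃`,
`p₄ = l² q₄`: either `l` can be chosen nonzero, or one of the two sides vanishes. -/
theorem exists_scale_or_eq_zero {p₁ p₂ p₃ p₄ q₁ q₂ q₃ q₄ : ℂ}
    (h12 : p₁ * q₂ = p₂ * q₁) (h34 : p₃ * q₄ = p₄ * q₃)
    (h311 : p₃ * q₁ ^ 2 = p₁ ^ 2 * q₃) (h322 : p₃ * q₂ ^ 2 = p₂ ^ 2 * q₃)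
    (h411 : p₄ * q₁ ^ 2 = p₁ ^ 2 * q₄) (h422 : p₄ * q₂ ^ 2 = p₂ ^ 2 * q₄) :
    (∃ l : ℂ, l ≠ 0 ∧ p₁ = l * q₁ ∧ p₂ = l * q₂ ∧ p₃ = l ^ 2 * q₃ ∧ p₄ = l ^ 2 * q₄) ∨
      (q₁ = 0 ∧ q₂ = 0 ∧ q₃ = 0 ∧ q₄ = 0) ∨ (p₁ = 0 ∧ p₂ = 0 ∧ p₃ = 0 ∧ p₄ = 0) := by
  by_cases c1 : p₁ ≠ 0 ∧ q₁ ≠ 0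
  · obtain ⟨hp, hq⟩ := c1
    refine Or.inl ⟨p₁ / q₁, div_ne_zero hp hq, ?_, ?_, ?_, ?_⟩ <;> field_simp <;> grind
  by_cases c2 : p₂ ≠ 0 ∧ q₂ ≠ 0
  · obtain ⟨hp, hq⟩ := c2
    refine Or.inl ⟨p₂ / q₂, div_ne_zero hp hq, ?_, ?_, ?_, ?_⟩ <;> field_simp <;> grind
  by_cases c3 : p₃ ≠ 0 ∧ q₃ ≠ 0
  · obtain ⟨hp, hq⟩ := c3
    obtain ⟨l, hl⟩ := IsAlgClosed.exists_pow_nat_eq (p₃ / q₃) (n := 2) two_pos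
    have hl0 : l ≠ 0 := by rintro rfl; simp [eq_comm, hp, hq] at hl
    refine Or.inl ⟨l, hl0, ?_, ?_, ?_, ?_⟩ <;> (try rw [hl]) <;> (try field_simp) <;> grind
  by_cases c4 : p₄ ≠ 0 ∧ q₄ ≠ 0
  · obtain ⟨hp, hq⟩ := c4
    obtain ⟨l, hl⟩ := IsAlgClosed.exists_pow_nat_eq (p₄ / q₄) (n := 2) two_pos
    have hl0 : l ≠ 0 := by rintro rfl; simp [eq_comm, hp, hq] at hl
    refine Or.inl ⟨l, hl0, ?_, ?_, ?_, ?_⟩ <;> (try rw [hl]) <;> (try field_simp) <;> grind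
  right
  grind

/-- Consider the `1:-2` resonant quintic family
`ẋ = x − a₀₁xy − a₂₀x³ − a₂₁x³y − a₀₂xy² − a₄₀x⁵`,
`ẏ = −2y + b₀₁y² + b₂₀x²y + b₂₁x²y² + b₀₂y³ + b₄₀x⁴y`,
encoded by coefficient functions `A, B : ℕ×ℕ → ℂ` (for `p = 1`, `q = 2`), where
`A(u,v) = a_{2u,v}` and `B(u,v) = b_{2u,v}`.  If the ten coefficients satisfy the nine
listed polynomial equations, then all saddle quantities vanish: `G(k) = 0` for every
`k ≥ 1`, so the system admits an analytic first integral of the form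
`x²y + higher order terms`. -/
theorem statement15
    (a01 a20 a02 a40 a21 b01 b20 b21 b02 b40 : ℂ)
    (A B : ℕ × ℕ → ℂ)
    (hA : ∀ u v : ℕ, A (u, v) =
      if (u, v) = (0, 1) then a01
      else if (u, v) = (1, 0) then a20
      else if (u, v) = (0, 2) then a02
      else if (u, v) = (2, 0) then a40
      else if (u, v) = (1, 1) then a21
      else 0)
    (hB : ∀ u v : ℕ, B (u, v) =
      if (u, v) = (0, 1) then b01
      else if (u, v) = (1, 0) then b20
      else if (u, v) = (1, 1) then b21
      else if (u, v) = (0, 2) then b02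
      else if (u, v) = (2, 0) then b40
      else 0)
    (h1 : 2 * a21 - b21 = 0)
    (h2 : a40 * b01 ^ 2 - 2 * a20 ^ 2 * b02 = 0)
    (h3 : 4 * a02 * a40 - b02 * b40 = 0)
    (h4 : 8 * a02 * a20 ^ 2 - b01 ^ 2 * b40 = 0)
    (h5 : 2 * a02 * a20 * b20 - a01 * b01 * b40 = 0)
    (h6 : 2 * a01 * a40 * b01 - a20 * b02 * b20 = 0)
    (h7 : 4 * a01 * a20 - b01 * b20 = 0)
    (h8 : a02 * b20 ^ 2 - 2 * a01 ^ 2 * b40 = 0)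
    (h9 : 8 * a01 ^ 2 * a40 - b02 * b20 ^ 2 = 0) :
    ∀ k : ℕ, 1 ≤ k → G 1 2 A B k = 0 := by
  have hcase := exists_scale_or_eq_zero (p₁ := 2 * a01) (p₂ := b01) (p₃ := 2 * a02) (p₄ := b02)
    (q₁ := b20) (q₂ := 2 * a20) (q₃ := b40) (q₄ := 2 * a40)
    (by linear_combination h7) (by linear_combination h3) (by linear_combination 2 * h8)
    (by linear_combination h4) (by linear_combination -h9) (by linear_combination -2 * h2)
  intro k _
  have hd : ∀ u, 2 * A (u, u) = B (u, u) := by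
    intro u
    rw [hA, hB]
    simp only [Prod.mk.injEq]
    split_ifs <;> first | omega | linear_combination h1 | simp
  rcases hcase with ⟨l, hl, e1, e2, e3, e4⟩ | ⟨e1, e2, e3, e4⟩ | ⟨e1, e2, e3, e4⟩
  · refine G_eq_zero_of_reversible hl (fun u v => ?_) k
    rw [hA, hB]
    rcases u with _ | _ | _ | u <;> rcases v with _ | _ | _ | v <;> simp <;>
      first
      | linear_combination e1
      | linear_combination -e2
      | linear_combination e3
      | linear_combination -e4
      | exact Or.inl (by linear_combination h1)
  · refine G_eq_zero_of_triangular (c := 1) one_ne_zero (fun u v huv => ?_) hd k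
    rw [hA, hB]
    simp only [Prod.mk.injEq]
    constructor <;> split_ifs <;> first | omega | grind
  · refine G_eq_zero_of_triangular (c := -1) (by norm_num) (fun u v huv => ?_) hd k
    rw [hA, hB]
    simp only [Prod.mk.injEq]
    constructor <;> split_ifs <;> first | omega | grind
end
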